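/- arXiv:1705.05624 — 3 statements merged into one kernel-verified Lean document; each statement's English description precedes it below -/
import Mathlib

section
/- (De Giorgi's lemma) For every positive integers n, k and constant A > 0, there exists C > 0 depending only on n, k, A such that: for every ball B(x,r) ⊂ ℝⁿ, every measurable set E ⊆ B(x,r) with Lⁿ(E) ≥ A rⁿ, every polynomial p: ℝⁿ → ℝ of degree at most k, and every multi-index α with |α| ≤ k, one has |D^α p(x)| ≤ (C / r^{n+|α|}) ∫_E |p(y)| dy. -/
open MeasureTheory Metric Filter Set

noncomputable section

/-- `ℝⁿ` as a Euclidean space. -/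
abbrev Ec (n : ℕ) := EuclideanSpace ℝ (Fin n)

/-- The order `|α|` of a multi-index `α`. -/
def mdeg {n : ℕ} (α : Fin n →₀ ℕ) : ℕ := α.sum fun _ m => m

/-- The iterated partial derivative `D^α p` of a multivariate polynomial. -/
def mvDeriv {n : ℕ} (α : Fin n →₀ ℕ) (p : MvPolynomial (Fin n) ℝ) :
    MvPolynomial (Fin n) ℝ :=
  (α.support.sort (· ≤ ·)).foldr (fun i q => (fun q' => MvPolynomial.pderiv i q')^[α i] q) p

/-! ### Zero sets of polynomials -/

/-- The zero set of a nonzero real polynomial is Lebesgue null. -/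
theorem volume_eval_eq_zero : ∀ {n : ℕ} (p : MvPolynomial (Fin n) ℝ), p ≠ 0 →
    volume {x : Fin n → ℝ | MvPolynomial.eval x p = 0} = 0
  | 0, p, hp => by
    rw [MvPolynomial.eq_C_of_isEmpty p] at hp ⊢
    have : MvPolynomial.coeff 0 p ≠ 0 := fun h => hp (by rw [h, map_zero])
    simp [this]
  | n + 1, p, hp => by
    set q := MvPolynomial.finSuccEquiv ℝ n p with hq
    have hq0 : q ≠ 0 := by simpa [hq] using hp
    have hlead := volume_eval_eq_zero q.leadingCoeff (by simpa using hq0)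
    set S := {x : Fin (n + 1) → ℝ | MvPolynomial.eval x p = 0} with hS
    have hSm : MeasurableSet S :=
      (isClosed_eq (MvPolynomial.continuous_eval p) continuous_const).measurableSet
    have he := (volume_preserving_piFinSuccAbove (fun _ : Fin (n + 1) => ℝ) 0).symm
    rw [← he.measure_preimage hSm.nullMeasurableSet, Measure.volume_eq_prod,
      Measure.prod_apply_symm (he.measurable hSm),
      lintegral_eq_zero_iff (measurable_measure_prodMk_right (he.measurable hSm))]
    filter_upwards [compl_mem_ae_iff.2 hlead] with y hy
    have hmap : q.map (MvPolynomial.eval y) ≠ 0 := by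
      intro h
      apply hy
      have := congrArg (fun r => r.coeff q.natDegree) h
      simpa using this
    refine (((q.map (MvPolynomial.eval y)).roots.toFinset.finite_toSet).subset ?_).measure_zero _
    intro t ht
    have ht' : MvPolynomial.eval (Fin.cons t y : Fin (n + 1) → ℝ) p = 0 := by
      simpa [hS, MeasurableEquiv.piFinSuccAbove, Fin.insertNthEquiv] using ht
    rw [MvPolynomial.eval_eq_eval_mv_eval'] at ht'
    simpa [hmap] using ht'

/-- A nonzero polynomial is nonzero almost everywhere on Euclidean space. -/
theorem ae_eval_ne_zero {n : ℕ} {p : MvPolynomial (Fin n) ℝ} (hp : p ≠ 0) :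
    ∀ᵐ y : Ec n, MvPolynomial.eval (fun i => y i) p ≠ 0 :=
  (PiLp.volume_preserving_ofLp (Fin n)).quasiMeasurePreserving.ae
    (p := fun y => MvPolynomial.eval y p ≠ 0)
    (by simpa [ae_iff] using volume_eval_eq_zero p hp)

/-! ### A uniform lower bound for `L¹` norms on large sets -/

section LowerBound

variable {X ι : Type*} [MeasurableSpace X] [Fintype ι]

theorem integrableOn_sum_mul {μ : Measure X} {B : Set X}
    (hB : MeasurableSet B) (hμ : μ B ≠ ⊤) {f : ι → X → ℝ} (hf : ∀ i, Measurable (f i))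
    (hf1 : ∀ i, ∀ x ∈ B, |f i x| ≤ 1) (a : ι → ℝ) :
    IntegrableOn (fun x => ∑ i, a i * f i x) B μ := by
  refine integrable_finsetSum _ fun i _ => Integrable.const_mul ?_ _
  exact Measure.integrableOn_of_bounded hμ (hf i).aestronglyMeasurable (M := 1)
    ((ae_restrict_iff' hB).2 (ae_of_all _ (hf1 i)))

theorem abs_sum_mul_le {v : ι → ℝ} (hv : ∀ i, |v i| ≤ 1) (a : ι → ℝ) :
    |∑ i, a i * v i| ≤ Fintype.card ι * ‖a‖ := by
  calc |∑ i, a i * v i| ≤ ∑ i, |a i * v i| := Finset.abs_sum_le_sum_abs _ _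
    _ ≤ ∑ _i : ι, ‖a‖ := by
      refine Finset.sum_le_sum fun i _ => ?_
      rw [abs_mul]
      calc |a i| * |v i| ≤ |a i| * 1 := by gcongr; exact hv i
        _ ≤ ‖a‖ := by simpa using norm_le_pi_norm a i
    _ = Fintype.card ι * ‖a‖ := by simp

theorem exists_measure_abs_le_lt {μ : Measure X} {B : Set X}
    (hB : MeasurableSet B) (hμ : μ B ≠ ⊤) {g : X → ℝ} (hg : Measurable g)
    (h0 : ∀ᵐ x ∂μ, g x ≠ 0) {ε : ℝ} (hε : 0 < ε) :
    ∃ δ > 0, μ.real (B ∩ {x | |g x| ≤ δ}) < ε := by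
  set S : ℕ → Set X := fun m => B ∩ {x | |g x| ≤ 1 / ((m : ℝ) + 1)} with hS
  have hSm : ∀ m, MeasurableSet (S m) := fun m =>
    hB.inter (measurableSet_le (by fun_prop) measurable_const)
  have hanti : Antitone S := fun m m' hmm x hx =>
    ⟨hx.1, le_trans (show |g x| ≤ _ from hx.2) (Nat.one_div_le_one_div hmm)⟩
  have hlim := tendsto_measure_iInter_atTop (μ := μ) (fun m => (hSm m).nullMeasurableSet) hanti
    ⟨0, ne_top_of_le_ne_top hμ (measure_mono inter_subset_left)⟩
  have hnull : μ (⋂ m, S m) = 0 := by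
    refine measure_mono_null (fun x hx => ?_) (ae_iff.1 h0)
    have hx' : ∀ m : ℕ, |g x| ≤ 1 / ((m : ℝ) + 1) := fun m => (mem_iInter.1 hx m).2
    have : |g x| ≤ 0 := ge_of_tendsto' tendsto_one_div_add_atTop_nhds_zero_nat hx'
    simpa using this
  rw [hnull] at hlim
  obtain ⟨m, hm⟩ := (hlim.eventually_lt_const (ENNReal.ofReal_pos.2 hε)).exists
  refine ⟨1 / ((m : ℝ) + 1), by positivity, ?_⟩
  exact (ENNReal.lt_ofReal_iff_toReal_lt (ne_top_of_lt hm)).1 hm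

theorem exists_eventually_le_setIntegral_abs {μ : Measure X} {B : Set X}
    (hB : MeasurableSet B) (hμ : μ B ≠ ⊤) {f : ι → X → ℝ} (hf : ∀ i, Measurable (f i))
    (hf1 : ∀ i, ∀ x ∈ B, |f i x| ≤ 1) {A : ℝ} (hA : 0 < A) {a : ι → ℝ}
    (h0 : ∀ᵐ x ∂μ, ∑ i, a i * f i x ≠ 0) :
    ∃ c > 0, ∀ᶠ b in nhds a, ∀ E, MeasurableSet E → E ⊆ B → A ≤ μ.real E →
      c ≤ ∫ x in E, |∑ i, b i * f i x| ∂μ := by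
  obtain ⟨δ, hδ, hlt⟩ := exists_measure_abs_le_lt hB hμ
    (g := fun x => ∑ i, a i * f i x) (by fun_prop) h0 (half_pos hA)
  set S := B ∩ {x | |∑ i, a i * f i x| ≤ δ} with hS
  have hSm : MeasurableSet S := hB.inter (measurableSet_le (by fun_prop) measurable_const)
  have hSfin : μ S ≠ ⊤ := ne_top_of_le_ne_top hμ (measure_mono inter_subset_left)
  have hnear : ∀ᶠ b in nhds a, Fintype.card ι * ‖a - b‖ < δ / 2 := by
    have hc : Continuous fun b : ι → ℝ => (Fintype.card ι : ℝ) * ‖a - b‖ := by fun_prop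
    exact hc.tendsto' a 0 (by simp) |>.eventually_lt_const (half_pos hδ)
  refine ⟨δ / 2 * (A / 2), by positivity, ?_⟩
  filter_upwards [hnear] with b hb E hE hEB hAE
  have hint : IntegrableOn (fun x => |∑ i, b i * f i x|) B μ :=
    (integrableOn_sum_mul hB hμ hf hf1 b).abs
  have hEfin : μ E ≠ ⊤ := ne_top_of_le_ne_top hμ (measure_mono hEB)
  have hdiff : A / 2 ≤ μ.real (E \ S) := by
    have := le_measureReal_sdiff (μ := μ) (s₁ := E) (s₂ := S) hSfin
    linarith
  have hlow : ∀ x ∈ E \ S, δ / 2 ≤ |∑ i, b i * f i x| := by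
    rintro x ⟨hxE, hxS⟩
    have h1 : δ < |∑ i, a i * f i x| := by
      by_contra! h
      exact hxS ⟨hEB hxE, h⟩
    have h2 := abs_sum_mul_le (fun i => hf1 i x (hEB hxE)) (a - b)
    have h3 : ∑ i, (a - b) i * f i x = ∑ i, a i * f i x - ∑ i, b i * f i x := by
      simp [sub_mul, Finset.sum_sub_distrib]
    rw [h3] at h2
    have h4 := abs_sub_abs_le_abs_sub (∑ i, a i * f i x) (∑ i, b i * f i x)
    linarith
  calc δ / 2 * (A / 2) ≤ δ / 2 * μ.real (E \ S) := by gcongr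
    _ ≤ ∫ x in E \ S, |∑ i, b i * f i x| ∂μ :=
      setIntegral_ge_of_const_le_real (hE.diff hSm)
        (ne_top_of_le_ne_top hEfin (measure_mono sdiff_subset)) hlow
        (hint.mono_set (sdiff_subset.trans hEB))
    _ ≤ ∫ x in E, |∑ i, b i * f i x| ∂μ :=
      setIntegral_mono_set (hint.mono_set hEB) (ae_of_all _ fun x => abs_nonneg _)
        sdiff_subset.eventuallyLE

/-- If no nontrivial linear combination of the bounded functions `f i` vanishes on a set of positive
measure, the `L¹` norm of a combination over any set of measure at least `A` controls its
coefficients. -/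
theorem exists_norm_le_setIntegral_abs {μ : Measure X} {B : Set X}
    (hB : MeasurableSet B) (hμ : μ B ≠ ⊤) {f : ι → X → ℝ} (hf : ∀ i, Measurable (f i))
    (hf1 : ∀ i, ∀ x ∈ B, |f i x| ≤ 1) {A : ℝ} (hA : 0 < A)
    (h0 : ∀ a : ι → ℝ, a ≠ 0 → ∀ᵐ x ∂μ, ∑ i, a i * f i x ≠ 0) :
    ∃ c > 0, ∀ (a : ι → ℝ) (E : Set X), MeasurableSet E → E ⊆ B → A ≤ μ.real E →
      c * ‖a‖ ≤ ∫ x in E, |∑ i, a i * f i x| ∂μ := by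
  have hsphere : ∃ c > 0, ∀ b ∈ sphere (0 : ι → ℝ) 1, ∀ E, MeasurableSet E → E ⊆ B →
      A ≤ μ.real E → c ≤ ∫ x in E, |∑ i, b i * f i x| ∂μ := by
    refine (isCompact_sphere (0 : ι → ℝ) 1).induction_on
      (p := fun s => ∃ c > 0, ∀ b ∈ s, ∀ E, MeasurableSet E → E ⊆ B →
        A ≤ μ.real E → c ≤ ∫ x in E, |∑ i, b i * f i x| ∂μ) ⟨1, one_pos, by simp⟩ ?_ ?_ ?_
    · rintro s t hst ⟨c, hc, h⟩
      exact ⟨c, hc, fun b hb => h b (hst hb)⟩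
    · rintro s t ⟨c, hc, h⟩ ⟨d, hd, h'⟩
      refine ⟨min c d, lt_min hc hd, ?_⟩
      rintro b (hb | hb) E hE hEB hAE
      · exact (min_le_left _ _).trans (h b hb E hE hEB hAE)
      · exact (min_le_right _ _).trans (h' b hb E hE hEB hAE)
    · intro a ha
      have ha0 : a ≠ 0 := by
        rintro rfl
        simp at ha
      obtain ⟨c, hc, h⟩ := exists_eventually_le_setIntegral_abs hB hμ hf hf1 hA (h0 a ha0)
      exact ⟨_, mem_nhdsWithin_of_mem_nhds h, c, hc, fun b hb => hb⟩
  obtain ⟨c, hc, h⟩ := hsphere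
  refine ⟨c, hc, fun a E hE hEB hAE => ?_⟩
  rcases eq_or_ne a 0 with rfl | ha
  · simp
  have hna : 0 < ‖a‖ := norm_pos_iff.2 ha
  have hb := h (‖a‖⁻¹ • a) (by simp [norm_smul, hna.ne']) E hE hEB hAE
  have hsum : ∀ x, |∑ i, (‖a‖⁻¹ • a) i * f i x| = ‖a‖⁻¹ * |∑ i, a i * f i x| := fun x => by
    rw [← abs_of_pos (inv_pos.2 hna), ← abs_mul, Finset.mul_sum, abs_of_pos (inv_pos.2 hna)]
    simp [mul_assoc]
  simp_rw [hsum] at hb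
  rw [integral_const_mul, inv_mul_eq_div, le_div_iff₀ hna] at hb
  exact hb

end LowerBound

/-! ### Iterated derivatives and affine changes of variables -/

/-- The polynomial `z ↦ p (x + r z)`. -/
def affineComp {n : ℕ} (x : Fin n → ℝ) (r : ℝ) :
    MvPolynomial (Fin n) ℝ →ₐ[ℝ] MvPolynomial (Fin n) ℝ :=
  MvPolynomial.bind₁ fun i => MvPolynomial.C (x i) + MvPolynomial.C r * MvPolynomial.X i

theorem eval_affineComp {n : ℕ} (x : Fin n → ℝ) (r : ℝ) (p : MvPolynomial (Fin n) ℝ)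
    (z : Fin n → ℝ) :
    MvPolynomial.eval z (affineComp x r p) = MvPolynomial.eval (fun i => x i + r * z i) p := by
  induction p using MvPolynomial.induction_on with
  | C a => simp [affineComp]
  | add p q hp hq => simp [hp, hq]
  | mul_X p j hp =>
    rw [map_mul, map_mul, hp]
    simp [affineComp]

theorem totalDegree_affineComp_le {n : ℕ} (x : Fin n → ℝ) (r : ℝ)
    (p : MvPolynomial (Fin n) ℝ) : (affineComp x r p).totalDegree ≤ p.totalDegree := by
  rw [affineComp, MvPolynomial.bind₁, MvPolynomial.aeval_def, MvPolynomial.eval₂_eq']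
  refine MvPolynomial.totalDegree_finsetSum_le fun d hd => ?_
  refine (MvPolynomial.totalDegree_mul _ _).trans ?_
  rw [MvPolynomial.algebraMap_eq, MvPolynomial.totalDegree_C, zero_add]
  refine (MvPolynomial.totalDegree_finsetProd _ _).trans ?_
  refine le_trans ?_ (MvPolynomial.le_totalDegree hd)
  rw [Finsupp.sum_fintype _ _ (fun _ => rfl)]
  refine Finset.sum_le_sum fun i _ => ?_
  refine (MvPolynomial.totalDegree_pow _ _).trans ?_
  refine (Nat.mul_le_mul_left _ (m := 1) ?_).trans_eq (mul_one _)
  refine (MvPolynomial.totalDegree_add _ _).trans (max_le (by simp) ?_)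
  refine (MvPolynomial.totalDegree_mul _ _).trans (by simp)

theorem pderiv_affineComp {n : ℕ} (x : Fin n → ℝ) (r : ℝ) (i : Fin n)
    (p : MvPolynomial (Fin n) ℝ) :
    MvPolynomial.pderiv i (affineComp x r p) = r • affineComp x r (MvPolynomial.pderiv i p) := by
  induction p using MvPolynomial.induction_on with
  | C a => simp [affineComp]
  | add p q hp hq => simp [hp, hq]
  | mul_X p j hp =>
    rw [map_mul, Derivation.leibniz, hp, Derivation.leibniz]
    have hX : affineComp x r (MvPolynomial.X j) =
        MvPolynomial.C (x j) + MvPolynomial.C r * MvPolynomial.X j := by simp [affineComp]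
    have hd : MvPolynomial.pderiv i (affineComp x r (MvPolynomial.X j)) =
        r • affineComp x r (MvPolynomial.pderiv i (MvPolynomial.X j)) := by
      rw [hX]
      by_cases h : j = i
      · subst h
        simp [MvPolynomial.smul_eq_C_mul]
      · simp [MvPolynomial.pderiv_X_of_ne h]
    rw [hd]
    simp only [smul_eq_mul, map_add, map_mul, smul_add, mul_smul_comm]

theorem iterate_pderiv_smul_affineComp {n : ℕ} (x : Fin n → ℝ) (r : ℝ) (i : Fin n) (m : ℕ)
    (c : ℝ) (p : MvPolynomial (Fin n) ℝ) :
    (fun q => MvPolynomial.pderiv i q)^[m] (c • affineComp x r p) =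
      (r ^ m * c) • affineComp x r ((fun q => MvPolynomial.pderiv i q)^[m] p) := by
  induction m with
  | zero => simp
  | succ m ih =>
    rw [Function.iterate_succ_apply', ih, Function.iterate_succ_apply', Derivation.map_smul,
      pderiv_affineComp, smul_smul]
    congr 1
    ring

theorem mvDeriv_affineComp {n : ℕ} (x : Fin n → ℝ) (r : ℝ) (α : Fin n →₀ ℕ)
    (p : MvPolynomial (Fin n) ℝ) :
    mvDeriv α (affineComp x r p) = r ^ mdeg α • affineComp x r (mvDeriv α p) := by
  have hlist : ∀ l : List (Fin n),
      l.foldr (fun i q => (fun q' => MvPolynomial.pderiv i q')^[α i] q) (affineComp x r p) =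
        r ^ (l.map α).sum • affineComp x r
          (l.foldr (fun i q => (fun q' => MvPolynomial.pderiv i q')^[α i] q) p) := by
    intro l
    induction l with
    | nil => simp
    | cons i l ih =>
      rw [List.foldr_cons, ih, iterate_pderiv_smul_affineComp, List.map_cons, List.sum_cons,
        pow_add, List.foldr_cons]
  have hsum : ((α.support.sort (· ≤ ·)).map α).sum = mdeg α := by
    rw [← Multiset.sum_coe, ← Multiset.map_coe, Finset.sort_eq]
    rfl
  rw [mvDeriv, hlist, hsum, mvDeriv]

theorem exists_linearMap_eq_mvDeriv {n : ℕ} (α : Fin n →₀ ℕ) :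
    ∃ L : MvPolynomial (Fin n) ℝ →ₗ[ℝ] MvPolynomial (Fin n) ℝ, ∀ p, mvDeriv α p = L p := by
  suffices h : ∀ l : List (Fin n), ∃ L : MvPolynomial (Fin n) ℝ →ₗ[ℝ] MvPolynomial (Fin n) ℝ,
      ∀ p, l.foldr (fun i q => (fun q' => MvPolynomial.pderiv i q')^[α i] q) p = L p from h _
  intro l
  induction l with
  | nil => exact ⟨LinearMap.id, fun p => rfl⟩
  | cons i l ih =>
    obtain ⟨L, hL⟩ := ih
    refine ⟨((MvPolynomial.pderiv i).toLinearMap ^ α i) ∘ₗ L, fun p => ?_⟩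
    rw [List.foldr_cons, hL, LinearMap.comp_apply, Module.End.pow_apply]
    rfl

/-! ### Estimates on the unit ball -/

/-- The multi-indices of order at most `k`. -/
def multiIndices (n k : ℕ) : Finset (Fin n →₀ ℕ) :=
  (Finsupp.finite_of_degree_le (σ := Fin n) k).toFinset

theorem mem_multiIndices {n k : ℕ} {α : Fin n →₀ ℕ} : α ∈ multiIndices n k ↔ α.degree ≤ k := by
  simp [multiIndices]

theorem sum_multiIndices_monomial {n k : ℕ} {p : MvPolynomial (Fin n) ℝ}
    (hp : p.totalDegree ≤ k) :
    ∑ d : multiIndices n k, MvPolynomial.coeff d p • MvPolynomial.monomial (d : Fin n →₀ ℕ) (1 : ℝ)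
      = p := by
  conv_rhs => rw [p.as_sum]
  rw [Finset.sum_coe_sort (multiIndices n k)
    (fun d => MvPolynomial.coeff d p • MvPolynomial.monomial d (1 : ℝ))]
  symm
  refine (Finset.sum_subset (fun d hd => ?_) (fun d _ hd => ?_)).trans
    (Finset.sum_congr rfl fun d _ => ?_)
  · exact mem_multiIndices.2 ((MvPolynomial.le_totalDegree hd).trans hp)
  · simpa using hd
  · simp [MvPolynomial.smul_monomial]

theorem exists_abs_eval_mvDeriv_le (n k : ℕ) :
    ∃ K > (0 : ℝ), ∀ p : MvPolynomial (Fin n) ℝ, p.totalDegree ≤ k →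
      ∀ α : Fin n →₀ ℕ, mdeg α ≤ k →
        |MvPolynomial.eval 0 (mvDeriv α p)| ≤
          K * ‖fun d : multiIndices n k => MvPolynomial.coeff (d : Fin n →₀ ℕ) p‖ := by
  set D : (Fin n →₀ ℕ) → ℝ := fun α => ∑ d : multiIndices n k,
    |MvPolynomial.eval 0 (mvDeriv α (MvPolynomial.monomial (d : Fin n →₀ ℕ) 1))| with hD
  have hD0 : ∀ α, 0 ≤ D α := fun α => Finset.sum_nonneg fun d _ => abs_nonneg _
  refine ⟨1 + ∑ α ∈ multiIndices n k, D α,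
    add_pos_of_pos_of_nonneg one_pos (Finset.sum_nonneg fun α _ => hD0 α), fun p hp α hα => ?_⟩
  obtain ⟨L, hL⟩ := exists_linearMap_eq_mvDeriv α
  have hle : D α ≤ 1 + ∑ α ∈ multiIndices n k, D α := by
    have := Finset.single_le_sum (fun β _ => hD0 β) (mem_multiIndices.2 hα)
    linarith
  refine le_trans ?_ (mul_le_mul_of_nonneg_right hle (norm_nonneg _))
  set a := fun d : multiIndices n k => MvPolynomial.coeff (d : Fin n →₀ ℕ) p with ha
  conv_lhs => rw [← sum_multiIndices_monomial hp, hL, map_sum, map_sum]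
  refine (Finset.abs_sum_le_sum_abs _ _).trans ?_
  rw [hD, Finset.sum_mul]
  refine Finset.sum_le_sum fun d _ => ?_
  rw [map_smul, MvPolynomial.smul_eval, abs_mul, mul_comm, hL]
  gcongr
  exact norm_le_pi_norm a d

theorem abs_eval_monomial_le_one {n : ℕ} (d : Fin n →₀ ℕ) {y : Ec n} (hy : y ∈ ball (0 : Ec n) 1) :
    |MvPolynomial.eval (fun i => y i) (MvPolynomial.monomial d (1 : ℝ))| ≤ 1 := by
  rw [MvPolynomial.eval_monomial, one_mul, Finsupp.prod, Finset.abs_prod]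
  refine Finset.prod_le_one (fun _ _ => abs_nonneg _) fun i _ => ?_
  rw [abs_pow]
  refine pow_le_one₀ (abs_nonneg _) ?_
  have h1 := PiLp.norm_apply_le y i
  have h2 : ‖y‖ < 1 := by simpa using hy
  exact h1.trans h2.le

theorem exists_norm_coeff_le_setIntegral (n k : ℕ) {A : ℝ} (hA : 0 < A) :
    ∃ c > (0 : ℝ), ∀ p : MvPolynomial (Fin n) ℝ, p.totalDegree ≤ k →
      ∀ E : Set (Ec n), MeasurableSet E → E ⊆ ball 0 1 → A ≤ volume.real E →
        c * ‖fun d : multiIndices n k => MvPolynomial.coeff (d : Fin n →₀ ℕ) p‖ ≤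
          ∫ y in E, |MvPolynomial.eval (fun i => y i) p| := by
  set f : multiIndices n k → Ec n → ℝ := fun d y =>
    MvPolynomial.eval (fun i => y i) (MvPolynomial.monomial (d : Fin n →₀ ℕ) (1 : ℝ)) with hf
  have heval : ∀ (a : multiIndices n k → ℝ) (y : Ec n), ∑ d, a d * f d y =
      MvPolynomial.eval (fun i => y i)
        (∑ d, a d • MvPolynomial.monomial (d : Fin n →₀ ℕ) (1 : ℝ)) := fun a y => by
    rw [map_sum]
    simp only [MvPolynomial.smul_eval, hf]
  have hfm : ∀ d, Measurable (f d) := fun d =>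
    ((MvPolynomial.continuous_eval _).comp (by fun_prop)).measurable
  obtain ⟨c, hc, h⟩ := exists_norm_le_setIntegral_abs (μ := (volume : Measure (Ec n)))
    (B := ball 0 1) measurableSet_ball measure_ball_lt_top.ne hfm
    (fun d y hy => abs_eval_monomial_le_one _ hy) hA (fun a ha => by
      simp_rw [heval]
      refine ae_eval_ne_zero fun h0 => ha (funext fun e => ?_)
      have := congrArg (MvPolynomial.coeff (e : Fin n →₀ ℕ)) h0
      simpa [MvPolynomial.coeff_sum, MvPolynomial.coeff_monomial, Subtype.ext_iff.symm] using this)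
  refine ⟨c, hc, fun p hp E hE hEB hAE => (h _ E hE hEB hAE).trans_eq ?_⟩
  simp_rw [heval]
  rw [sum_multiIndices_monomial hp]

theorem setIntegral_eq_pow_mul_setIntegral_affine {n : ℕ} (x : Ec n) {r : ℝ} (hr : 0 < r)
    {E : Set (Ec n)} (hE : MeasurableSet E) (F : Ec n → ℝ) :
    ∫ y in E, F y = r ^ n * ∫ z in (fun z => x + r • z) ⁻¹' E, F (x + r • z) := by
  have hm : Measurable fun z : Ec n => x + r • z := by fun_prop
  rw [← integral_indicator hE, ← integral_indicator (hm hE)]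
  have h1 := Measure.integral_comp_smul_of_nonneg (volume : Measure (Ec n))
    (fun y => E.indicator F (x + y)) r (hR := hr.le)
  rw [integral_add_left_eq_self (fun y => E.indicator F y) x, finrank_euclideanSpace_fin] at h1
  have h2 : ((fun z => x + r • z) ⁻¹' E).indicator (fun z => F (x + r • z)) =
      fun z => E.indicator F (x + r • z) := by
    ext z
    rfl
  rw [h2, h1, smul_eq_mul, mul_inv_cancel_left₀ (pow_pos hr n).ne']

/-- De Giorgi's lemma: for all positive integers `n, k` and `A > 0` there is
`C > 0`, depending only on `n, k, A`, such that for every ball `B(x,r) ⊆ ℝⁿ`, every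
measurable `E ⊆ B(x,r)` with `Lⁿ(E) ≥ A rⁿ`, every polynomial `p` of degree at most `k`
and every multi-index `|α| ≤ k`,
`|D^α p(x)| ≤ (C / r^{n+|α|}) ∫_E |p(y)| dy`. -/
theorem deGiorgi {n k : ℕ} (hn : 0 < n) (hk : 0 < k) (A : ℝ) (hA : 0 < A) :
    ∃ C > (0 : ℝ), ∀ (x : Ec n) (r : ℝ), 0 < r →
      ∀ E : Set (Ec n), MeasurableSet E → E ⊆ ball x r →
        A * r ^ n ≤ (volume E).toReal →
      ∀ p : MvPolynomial (Fin n) ℝ, p.totalDegree ≤ k →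
      ∀ α : Fin n →₀ ℕ, mdeg α ≤ k →
        |MvPolynomial.eval (fun i => x i) (mvDeriv α p)| ≤
          (C / r ^ (n + mdeg α)) * ∫ y in E, |MvPolynomial.eval (fun i => y i) p| := by
  obtain ⟨K, hK, hder⟩ := exists_abs_eval_mvDeriv_le n k
  obtain ⟨c, hc, hlow⟩ := exists_norm_coeff_le_setIntegral n k hA
  refine ⟨K / c, by positivity, fun x r hr E hE hEB hAE p hp α hα => ?_⟩
  set E' : Set (Ec n) := (fun z => x + r • z) ⁻¹' E with hE'
  set q := affineComp (fun i => x i) r p with hq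
  have hqk : q.totalDegree ≤ k := (totalDegree_affineComp_le _ _ _).trans hp
  have hm : Measurable fun z : Ec n => x + r • z := by fun_prop
  have hrn : 0 < r ^ n := pow_pos hr n
  have hE'B : E' ⊆ ball 0 1 := fun z hz => by
    have h : ‖r • z‖ < r := by simpa [mem_ball, dist_eq_norm] using hEB hz
    rw [norm_smul, Real.norm_of_nonneg hr.le] at h
    simpa using lt_of_mul_lt_mul_left (h.trans_eq (mul_one r).symm) hr.le
  have hAE' : A ≤ volume.real E' := by
    have h := setIntegral_eq_pow_mul_setIntegral_affine x hr hE (fun _ => (1 : ℝ))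
    simp only [integral_const, smul_eq_mul, mul_one, measureReal_restrict_apply_univ] at h
    change A * r ^ n ≤ volume.real E at hAE
    rw [h, mul_comm] at hAE
    exact le_of_mul_le_mul_left hAE hrn
  have hint : ∫ y in E, |MvPolynomial.eval (fun i => y i) p| =
      r ^ n * ∫ z in E', |MvPolynomial.eval (fun i => z i) q| := by
    rw [setIntegral_eq_pow_mul_setIntegral_affine x hr hE]
    simp [hq, eval_affineComp, hE']
  have h1 := hder q hqk α hα
  rw [hq, mvDeriv_affineComp, MvPolynomial.smul_eval, eval_affineComp, ← hq, abs_mul,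
    abs_of_pos (pow_pos hr _)] at h1
  simp only [Pi.zero_apply, mul_zero, add_zero] at h1
  have h2 := hlow q hqk E' (hm hE) hE'B hAE'
  rw [hint, pow_add]
  set I := ∫ z in E', |MvPolynomial.eval (fun i => z i) q|
  have h3 : K / c * I / r ^ mdeg α = K / (r ^ n * r ^ mdeg α) / c * (r ^ n * I) := by
    field_simp
  rw [div_right_comm, ← h3, le_div_iff₀ (pow_pos hr _), mul_comm]
  refine h1.trans ?_
  rw [div_mul_eq_mul_div, le_div_iff₀ hc, mul_assoc, mul_comm _ c]
  gcongr

end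
end

section
/- (Norton, part i) Let k ≥ 1 be an integer, t ∈ (0,1], and f: ℝⁿ → ℝᵐ of class C^{k,t}. If E is a subset of the critical set C_f = {x : rank Df(x) < m} with H^{k+t+m-1}(E) = 0, then Lᵐ(f(E)) = 0. -/
open MeasureTheory Metric Filter Set

noncomputable section

/-- The set `A` has vanishing Lebesgue density at `x`. -/
def apSmall {n : ℕ} (x : Ec n) (A : Set (Ec n)) : Prop :=
  Tendsto (fun r : ℝ => volume (A ∩ ball x r) / volume (ball x r))
    (nhdsWithin 0 (Ioi 0)) (nhds 0)

/-- `f` is approximately differentiable of order `k` at `x`, with Taylor polynomial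
`y ↦ ∑_{j ≤ k} (p j) (y-x)^j = p.partialSum (k+1) (y-x)` (here the coefficient maps `p j`
already incorporate the factor `1/j!`): the approximate limit of
`|f y - p_k(x;y)|/|y-x|^k` as `y → x` is `0`. -/
def IsApproxTaylor {n m : ℕ} (f : Ec n → Ec m) (k : ℕ) (x : Ec n)
    (p : FormalMultilinearSeries ℝ (Ec n) (Ec m)) : Prop :=
  ∀ ε > (0 : ℝ),
    apSmall x {y | y ≠ x ∧ ε * ‖y - x‖ ^ k ≤ ‖f y - p.partialSum (k + 1) (y - x)‖}
/-- The rank of the derivative of `f` at `x`. -/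
def derivRank {n m : ℕ} (f : Ec n → Ec m) (x : Ec n) : ℕ :=
  Module.finrank ℝ (LinearMap.range ((fderiv ℝ f x : Ec n →L[ℝ] Ec m) : Ec n →ₗ[ℝ] Ec m))

section

open Asymptotics unitInterval
open scoped Topology ENNReal NNReal

section Calculus

variable {E F G : Type*} [NormedAddCommGroup E] [NormedSpace ℝ E]
  [NormedAddCommGroup F] [NormedSpace ℝ F] [NormedAddCommGroup G] [NormedSpace ℝ G]
  {k : ℕ} {α : I}

/-- A function of class `C^{k+1}` whose derivative is of class `C^{k+(α)}` is of class
`C^{k+1+(α)}`. -/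
theorem ContDiffPointwiseHolderAt.of_fderiv {f : E → F} {a : E} (hf : ContDiffAt ℝ (k + 1 : ℕ) f a)
    (hd : ContDiffPointwiseHolderAt k α (fderiv ℝ f) a) :
    ContDiffPointwiseHolderAt (k + 1) α f a where
  contDiffAt := hf
  isBigO := .of_norm_left <| by
    simpa [iteratedFDeriv_succ_eq_comp_right, Function.comp_def, ← dist_eq_norm_sub]
      using hd.isBigO.norm_left

/-- The inverse of a local diffeomorphism of class `C^{k+(α)}` is of class `C^{k+(α)}`. -/
theorem OpenPartialHomeomorph.contDiffPointwiseHolderAt_symm [CompleteSpace E]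
    (e : OpenPartialHomeomorph E F) {a : E} (ha : a ∈ e.source) (e' : E ≃L[ℝ] F)
    (he' : HasFDerivAt e (e' : E →L[ℝ] F) a) (hk : k ≠ 0)
    (h : ContDiffPointwiseHolderAt k α e a) :
    ContDiffPointwiseHolderAt k α e.symm (e a) := by
  have hb : e a ∈ e.target := e.map_source ha
  have hsa : e.symm (e a) = a := e.left_inv ha
  have hcd : ContDiffAt ℝ k e.symm (e a) :=
    e.contDiffAt_symm hb (by rwa [hsa]) (by rw [hsa]; exact h.contDiffAt)
  have hd1 : ContDiffAt ℝ 1 e a := h.contDiffAt.of_le (mod_cast Nat.one_le_iff_ne_zero.2 hk)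
  have hfd : fderiv ℝ e a = e' := he'.fderiv
  have hderiv : (fun y ↦ (fderiv ℝ e (e.symm y)).inverse) =ᶠ[𝓝 (e a)] fderiv ℝ e.symm := by
    have h1 : ∀ᶠ x in 𝓝 a, fderiv ℝ e x ∈ range ((↑) : (E ≃L[ℝ] F) → E →L[ℝ] F) :=
      (hd1.fderiv_right (m := 0) (by simp)).continuousAt.eventually
        (by rw [hfd]; exact ContinuousLinearEquiv.nhds e')
    have h2 : ∀ᶠ x in 𝓝 a, DifferentiableAt ℝ e x :=
      (hd1.eventually (by simp)).mono fun x hx ↦ hx.differentiableAt one_ne_zero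
    have h3 : Tendsto e.symm (𝓝 (e a)) (𝓝 a) := e.tendsto_symm ha
    filter_upwards [h3.eventually h1, h3.eventually h2, e.open_target.mem_nhds hb]
      with y ⟨L, hL⟩ hy hyt
    have : HasFDerivAt e (L : E →L[ℝ] F) (e.symm y) := hL ▸ hy.hasFDerivAt
    rw [(e.hasFDerivAt_symm hyt this).fderiv, ← hL, ContinuousLinearMap.inverse_equiv]
  have key : ∀ j ≤ k, ContDiffPointwiseHolderAt j α e.symm (e a) := by
    intro j
    induction j with
    | zero =>
      exact fun _ ↦ hcd.contDiffPointwiseHolderAt (mod_cast Nat.pos_of_ne_zero hk) α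
    | succ j ih =>
      intro hj
      refine .of_fderiv (hcd.of_le (mod_cast hj)) (.congr_of_eventuallyEq ?_ hderiv)
      have hinv : ContDiffAt ℝ (j + 1 : ℕ) ContinuousLinearMap.inverse (fderiv ℝ e a) := by
        rw [hfd]; exact contDiffAt_map_inverse e'
      have h1 : ContDiffPointwiseHolderAt j α (fun x ↦ (fderiv ℝ e x).inverse) a :=
        (hinv.contDiffPointwiseHolderAt (mod_cast j.lt_succ_self) α).comp_of_differentiableAt a
          (h.fderiv hj) (.inl (hinv.differentiableAt (by simp)))
      rw [← hsa] at h1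
      exact h1.comp_of_differentiableAt (e a) (ih (by lia))
        (.inr (hcd.differentiableAt (by exact_mod_cast hk)))
  exact key k le_rfl

/-- Inverse function theorem in the class `C^{k+(α)}`. -/
theorem ContDiffAt.exists_local_leftInverse [FiniteDimensional ℝ E] [FiniteDimensional ℝ F]
    {h : E → F} {a₀ : E} (hk : k ≠ 0) (hh : ContDiffAt ℝ k h a₀)
    (hinj : Function.Injective (fderiv ℝ h a₀))
    (hdim : Module.finrank ℝ E = Module.finrank ℝ F) :
    ∃ g : F → E, ∀ᶠ a in 𝓝 a₀, g (h a) = a ∧ (∀ᶠ p in 𝓝 (h a), h (g p) = p) ∧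
      (∀ α : I, ContDiffPointwiseHolderAt k α h a → ContDiffPointwiseHolderAt k α g (h a)) := by
  have : CompleteSpace E := FiniteDimensional.complete ℝ E
  let h' : E ≃L[ℝ] F :=
    (LinearMap.linearEquivOfInjective (fderiv ℝ h a₀ : E →ₗ[ℝ] F) hinj hdim).toContinuousLinearEquiv
  have hh'eq : (h' : E →L[ℝ] F) = fderiv ℝ h a₀ := by ext x; rfl
  have hk' : (k : WithTop ℕ∞) ≠ 0 := mod_cast hk
  have hh' : HasFDerivAt h (h' : E →L[ℝ] F) a₀ := by
    rw [hh'eq]; exact (hh.differentiableAt hk').hasFDerivAt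
  let e := hh.toOpenPartialHomeomorph h hh' hk'
  have hd1 : ContDiffAt ℝ 1 h a₀ := hh.of_le (mod_cast Nat.one_le_iff_ne_zero.2 hk)
  have h1 : ∀ᶠ x in 𝓝 a₀, fderiv ℝ h x ∈ range ((↑) : (E ≃L[ℝ] F) → E →L[ℝ] F) :=
    (hd1.fderiv_right (m := 0) (by simp)).continuousAt.eventually
      (by rw [← hh'eq]; exact ContinuousLinearEquiv.nhds h')
  have h2 : ∀ᶠ x in 𝓝 a₀, DifferentiableAt ℝ h x :=
    (hd1.eventually (by simp)).mono fun x hx ↦ hx.differentiableAt one_ne_zero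
  refine ⟨e.symm, ?_⟩
  filter_upwards [h1, h2, e.open_source.mem_nhds (hh.mem_toOpenPartialHomeomorph_source hh' hk')]
    with a ⟨L, hL⟩ ha has
  refine ⟨e.left_inv has, ?_, fun α hα ↦ ?_⟩
  · exact e.eventually_right_inverse (e.map_source has)
  · exact e.contDiffPointwiseHolderAt_symm has L (by rw [hL]; exact ha.hasFDerivAt) hk hα

end Calculus

/-- A surjective linear map is, up to an isomorphism, the projection of a product to its first
factor. -/
theorem exists_equiv_prod_of_surjective {V R : Type*} [NormedAddCommGroup V] [NormedSpace ℝ V]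
    [FiniteDimensional ℝ V] [NormedAddCommGroup R] [NormedSpace ℝ R] [FiniteDimensional ℝ R]
    (T : V →L[ℝ] R) (hT : Function.Surjective T) {d : ℕ}
    (hd : Module.finrank ℝ V = Module.finrank ℝ R + d) :
    ∃ L : V ≃L[ℝ] R × Ec d, ∀ v, (L v).1 = T v := by
  have hker : Module.finrank ℝ (LinearMap.ker (T : V →ₗ[ℝ] R)) = d := by
    have := LinearMap.finrank_range_add_finrank_ker (T : V →ₗ[ℝ] R)
    rw [LinearMap.range_eq_top.2 hT, finrank_top] at this
    lia
  obtain ⟨p, hp⟩ := LinearMap.exists_leftInverse_of_injective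
    (LinearMap.ker (T : V →ₗ[ℝ] R)).subtype (by simp)
  let e : LinearMap.ker (T : V →ₗ[ℝ] R) ≃ₗ[ℝ] Ec d :=
    LinearEquiv.ofFinrankEq _ _ (by simp [hker])
  let M : V →ₗ[ℝ] R × Ec d := (T : V →ₗ[ℝ] R).prod (e.toLinearMap ∘ₗ p)
  have hM : Function.Injective M := by
    rw [injective_iff_map_eq_zero]
    intro v hv
    have h1 : T v = 0 := congrArg Prod.fst hv
    have h2 : p v = 0 := by simpa [M] using congrArg Prod.snd hv
    have h3 : p v = ⟨v, h1⟩ := LinearMap.congr_fun hp ⟨v, h1⟩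
    rw [h2] at h3
    exact (congrArg Subtype.val h3).symm
  refine ⟨(LinearMap.linearEquivOfInjective M hM (by simp [hd])).toContinuousLinearEquiv,
    fun v ↦ rfl⟩

section Decomposition

variable {P : Type} [NormedAddCommGroup P] [NormedSpace ℝ P]
  {W : Type} [NormedAddCommGroup W]

/-- `B ⊆ P × ℝᵈ` is contained in the image of a `C¹` family, parametrized by `P`, of submanifolds
of the fibers, along which `f` vanishes to order `s` at the points of `B`. The submanifolds are
parametrized by `ψ`, and `π` is a left inverse of `ψ`. -/
def IsFlatPiece (s : ℝ) {d : ℕ} (f : P × Ec d → W) (B : Set (P × Ec d)) : Prop :=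
  ∃ (d' : ℕ) (ψ : P × Ec d' → P × Ec d) (π : P × Ec d → P × Ec d'), ∀ a ∈ B,
    ContDiffAt ℝ 1 π a ∧ ψ (π a) = a ∧ ContDiffAt ℝ 1 ψ (π a) ∧
    (∀ᶠ p in 𝓝 (π a), (ψ p).1 = p.1) ∧
    (fun v ↦ f (ψ ((π a).1, v))) =O[𝓝 (π a).2] (fun v ↦ ‖v - (π a).2‖ ^ s)

/-- `A` is covered by countably many flat pieces. -/
def IsCountablyFlat (s : ℝ) {d : ℕ} (f : P × Ec d → W) (A : Set (P × Ec d)) : Prop :=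
  ∃ S : Set (Set (P × Ec d)), S.Countable ∧ (∀ B ∈ S, IsFlatPiece s f B) ∧ A ⊆ ⋃₀ S

variable {s : ℝ} {d : ℕ} {f : P × Ec d → W} {A B : Set (P × Ec d)}

theorem IsCountablyFlat.mono (h : IsCountablyFlat s f B) (hAB : A ⊆ B) : IsCountablyFlat s f A :=
  let ⟨S, hc, hS, hB⟩ := h
  ⟨S, hc, hS, hAB.trans hB⟩

theorem IsCountablyFlat.sUnion {T : Set (Set (P × Ec d))} (hT : T.Countable)
    (h : ∀ B ∈ T, IsCountablyFlat s f B) : IsCountablyFlat s f (⋃₀ T) := by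
  choose! S hc hS hB using h
  refine ⟨⋃ B ∈ T, S B, hT.biUnion hc, ?_, ?_⟩
  · simp only [mem_iUnion]
    rintro B ⟨C, hC, hBC⟩
    exact hS C hC B hBC
  · rintro x ⟨C, hC, hx⟩
    obtain ⟨D, hD, hxD⟩ := hB C hC hx
    exact ⟨D, mem_biUnion hC hD, hxD⟩

theorem IsCountablyFlat.union (hA : IsCountablyFlat s f A) (hB : IsCountablyFlat s f B) :
    IsCountablyFlat s f (A ∪ B) := by
  rw [← sUnion_pair]
  refine .sUnion (by simp) ?_
  rintro C (rfl | rfl) <;> assumption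

theorem IsCountablyFlat.of_locally [FiniteDimensional ℝ P]
    (h : ∀ x ∈ A, ∃ t ∈ 𝓝[A] x, IsCountablyFlat s f t) : IsCountablyFlat s f A := by
  have := FiniteDimensional.proper ℝ P
  have hL : IsLindelof A := HereditarilyLindelofSpace.isLindelof A
  exact hL.induction_on (fun _ _ hst ht ↦ ht.mono hst) (fun _ hS h ↦ .sUnion hS h) h

variable [NormedSpace ℝ W]

/-- If the fiberwise derivative of `f` is of order `s` along a fiberwise submanifold, then `f` is
constant up to order `s + 1` along it. -/
theorem isBigO_sub_of_fderiv_comp_inr {d' : ℕ} {ψ : P × Ec d' → P × Ec d} {b : P × Ec d'}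
    (hs : 0 ≤ s) (hf : ContDiffAt ℝ 1 f (ψ b)) (hψ : ContDiffAt ℝ 1 ψ b)
    (hfst : ∀ᶠ p in 𝓝 b, (ψ p).1 = p.1)
    (hO : (fun v ↦ (fderiv ℝ f (ψ (b.1, v))).comp (.inr ℝ P (Ec d)))
      =O[𝓝 b.2] (fun v ↦ ‖v - b.2‖ ^ s)) :
    (fun v ↦ f (ψ (b.1, v)) - f (ψ b)) =O[𝓝 b.2] (fun v ↦ ‖v - b.2‖ ^ (s + 1)) := by
  obtain ⟨x, v₀⟩ := b
  dsimp only at *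
  obtain ⟨C, hC0, hC⟩ := hO.exists_nonneg
  rw [IsBigOWith] at hC
  have hslice : Tendsto (fun v : Ec d' ↦ (x, v)) (𝓝 v₀) (𝓝 (x, v₀)) :=
    (Continuous.prodMk_right x).tendsto v₀
  have hψc : Tendsto ψ (𝓝 (x, v₀)) (𝓝 (ψ (x, v₀))) := hψ.continuousAt
  have hfd : ∀ᶠ p in 𝓝 (x, v₀), DifferentiableAt ℝ f (ψ p) :=
    hψc.eventually ((hf.eventually (by simp)).mono fun _ h ↦ h.differentiableAt one_ne_zero)
  have hψd : ∀ᶠ p in 𝓝 (x, v₀), DifferentiableAt ℝ ψ p :=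
    (hψ.eventually (by simp)).mono fun _ h ↦ h.differentiableAt one_ne_zero
  obtain ⟨M, hM⟩ : ∃ M : ℝ, ∀ᶠ p in 𝓝 (x, v₀), ‖fderiv ℝ ψ p‖ ≤ M :=
    ⟨‖fderiv ℝ ψ (x, v₀)‖ + 1, ((hψ.fderiv_right (m := 0) (by simp)).continuousAt.norm.eventually
      (gt_mem_nhds (lt_add_one _))).mono fun _ h ↦ le_of_lt h⟩
  have hall : ∀ᶠ v in 𝓝 v₀, (∀ᶠ p in 𝓝 (x, v), (ψ p).1 = p.1) ∧ DifferentiableAt ℝ f (ψ (x, v)) ∧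
      DifferentiableAt ℝ ψ (x, v) ∧ ‖fderiv ℝ ψ (x, v)‖ ≤ M ∧
      ‖(fderiv ℝ f (ψ (x, v))).comp (.inr ℝ P (Ec d))‖ ≤ C * ‖‖v - v₀‖ ^ s‖ := by
    filter_upwards [hslice.eventually hfst.eventually_nhds, hslice.eventually hfd,
      hslice.eventually hψd, hslice.eventually hM, hC] with v h1 h2 h3 h4 h5
    exact ⟨h1, h2, h3, h4, h5⟩
  obtain ⟨ε, hε, hball⟩ := Metric.eventually_nhds_iff_ball.1 hall
  have hM0 : 0 ≤ M := (norm_nonneg _).trans (hball v₀ (mem_ball_self hε)).2.2.2.1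
  refine .of_bound (C * M) ?_
  filter_upwards [ball_mem_nhds v₀ hε] with v hv
  set ρ := ‖v - v₀‖ with hρ
  have hρε : ρ < ε := by rwa [mem_ball_iff_norm] at hv
  have hder : ∀ w ∈ closedBall v₀ ρ,
      HasFDerivWithinAt (fun v ↦ f (ψ (x, v)))
        ((fderiv ℝ f (ψ (x, w))).comp ((fderiv ℝ ψ (x, w)).comp (.inr ℝ P (Ec d'))))
        (closedBall v₀ ρ) w := by
    intro w hw
    obtain ⟨-, h2, h3, -, -⟩ := hball w (closedBall_subset_ball hρε hw)
    have h4 : HasFDerivAt (fun v : Ec d' ↦ (x, v)) (.inr ℝ P (Ec d')) w := hasFDerivAt_prodMk_right x w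
    exact (h2.hasFDerivAt.comp w (h3.hasFDerivAt.comp w h4)).hasFDerivWithinAt
  have hbound : ∀ w ∈ closedBall v₀ ρ,
      ‖(fderiv ℝ f (ψ (x, w))).comp ((fderiv ℝ ψ (x, w)).comp (.inr ℝ P (Ec d')))‖
        ≤ C * M * ρ ^ s := by
    intro w hw
    obtain ⟨h1, h2, h3, h4, h5⟩ := hball w (closedBall_subset_ball hρε hw)
    have hz : ∀ u, (fderiv ℝ ψ (x, w) (0, u)).1 = 0 := by
      intro u
      have e1 : HasFDerivAt (fun p ↦ (ψ p).1) ((ContinuousLinearMap.fst ℝ P (Ec d)).comp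
        (fderiv ℝ ψ (x, w))) (x, w) := hasFDerivAt_fst.comp (x, w) h3.hasFDerivAt
      have e2 : HasFDerivAt (fun p ↦ (ψ p).1) (.fst ℝ P (Ec d')) (x, w) :=
        hasFDerivAt_fst.congr_of_eventuallyEq h1
      exact DFunLike.congr_fun (e1.unique e2) (0, u)
    have hwρ : ‖w - v₀‖ ≤ ρ := by rwa [mem_closedBall_iff_norm] at hw
    have h6 : ‖‖w - v₀‖ ^ s‖ ≤ ρ ^ s := by
      rw [Real.norm_of_nonneg (by positivity)]; gcongr
    refine ContinuousLinearMap.opNorm_le_bound _ (by positivity) fun u ↦ ?_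
    have h7 : fderiv ℝ ψ (x, w) (0, u) = (0, (fderiv ℝ ψ (x, w) (0, u)).2) :=
      Prod.ext (hz u) rfl
    calc ‖fderiv ℝ f (ψ (x, w)) (fderiv ℝ ψ (x, w) (0, u))‖
        = ‖(fderiv ℝ f (ψ (x, w))).comp (.inr ℝ P (Ec d)) (fderiv ℝ ψ (x, w) (0, u)).2‖ := by
          rw [h7]; rfl
      _ ≤ ‖(fderiv ℝ f (ψ (x, w))).comp (.inr ℝ P (Ec d))‖ * ‖(fderiv ℝ ψ (x, w) (0, u)).2‖ :=
          ContinuousLinearMap.le_opNorm _ _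
      _ ≤ (C * ρ ^ s) * (M * ‖u‖) := by
          gcongr
          · exact h5.trans (by gcongr)
          · refine (norm_snd_le _).trans ((ContinuousLinearMap.le_opNorm _ _).trans ?_)
            gcongr
            simp [Prod.norm_def]
      _ = C * M * ρ ^ s * ‖u‖ := by ring
  have hmvt := (convex_closedBall v₀ ρ).norm_image_sub_le_of_norm_hasFDerivWithin_le hder hbound
    (mem_closedBall_self (norm_nonneg _)) (mem_closedBall_iff_norm.2 le_rfl : v ∈ closedBall v₀ ρ)
  refine hmvt.trans_eq ?_
  rw [Real.norm_of_nonneg (by positivity), ← hρ, Real.rpow_add_one' (norm_nonneg _) (by positivity)]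
  ring

/-- Near a point where the fiberwise derivative of `f` does not vanish, the zeros of `f` lie on a
fiberwise hypersurface. This reduces the dimension of the fibers. -/
theorem exists_nhds_isCountablyFlat_of_fderiv_comp_inr_ne_zero [FiniteDimensional ℝ P]
    {k : ℕ} {α : unitInterval} (hk : k ≠ 0) {f : P × Ec (d + 1) → W} {A : Set (P × Ec (d + 1))}
    (ih : ∀ (f' : P × Ec d → W) (A' : Set (P × Ec d)),
      (∀ a ∈ A', ContDiffPointwiseHolderAt k α f' a) → (∀ a ∈ A', f' a = 0) →
      IsCountablyFlat s f' A')
    (hf : ∀ a ∈ A, ContDiffPointwiseHolderAt k α f a) (hA : ∀ a ∈ A, f a = 0)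
    {a₀ : P × Ec (d + 1)} (ha₀ : a₀ ∈ A)
    (hne : (fderiv ℝ f a₀).comp (.inr ℝ P (Ec (d + 1))) ≠ 0) :
    ∃ t ∈ 𝓝[A] a₀, IsCountablyFlat s f t := by
  obtain ⟨v, hv⟩ := DFunLike.ne_iff.1 hne
  obtain ⟨l, -, hl⟩ := exists_dual_vector ℝ _ (norm_ne_zero_iff.2 hv)
  let T : Ec (d + 1) →L[ℝ] ℝ := l.comp ((fderiv ℝ f a₀).comp (.inr ℝ P (Ec (d + 1))))
  have hTv : T v ≠ 0 := Eq.trans_ne hl (by simpa using hv)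
  have hT : Function.Surjective T := fun c ↦ ⟨(c / T v) • v, by simp [hTv]⟩
  obtain ⟨L, hL⟩ := exists_equiv_prod_of_surjective T hT (d := d) (by simp; ring)
  let q : Ec (d + 1) →L[ℝ] Ec d := (ContinuousLinearMap.snd ℝ ℝ (Ec d)).comp L.toContinuousLinearMap
  let π₀ : P × Ec (d + 1) →L[ℝ] P × Ec d := (ContinuousLinearMap.fst ..).prod (q.comp (.snd ..))
  let Q : P × Ec (d + 1) →L[ℝ] Ec d := q.comp (.snd ..)
  let h : P × Ec (d + 1) → P × (ℝ × Ec d) := fun p ↦ (p.1, (l (f p), Q p))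
  have hh : ∀ a ∈ A, ContDiffPointwiseHolderAt k α h a := fun a ha ↦
    .prodMk .fst (((hf a ha).continuousLinearMap_comp l).prodMk Q.contDiffPointwiseHolderAt)
  have hfa₀ : HasFDerivAt f (fderiv ℝ f a₀) a₀ := ((hf a₀ ha₀).differentiableAt hk).hasFDerivAt
  have hhd : HasFDerivAt h ((ContinuousLinearMap.fst ℝ P (Ec (d + 1))).prod
      ((l.comp (fderiv ℝ f a₀)).prod Q)) a₀ :=
    hasFDerivAt_fst.prodMk ((l.hasFDerivAt.comp a₀ hfa₀).prodMk Q.hasFDerivAt)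
  have hinj : Function.Injective (fderiv ℝ h a₀) := by
    rw [hhd.fderiv, injective_iff_map_eq_zero]
    rintro ⟨x, w⟩ hxw
    obtain rfl : x = 0 := congrArg Prod.fst hxw
    have h1 : T w = 0 := congrArg (fun p ↦ p.2.1) hxw
    have h2 : (L w).2 = 0 := congrArg (fun p ↦ p.2.2) hxw
    have h3 : L w = 0 := Prod.ext ((hL w).trans h1) h2
    rw [L.map_eq_zero_iff.1 h3]; rfl
  obtain ⟨g, hg⟩ := (hh a₀ ha₀).contDiffAt.exists_local_leftInverse hk hinj (by simp; ring)
  let j : P × Ec d →L[ℝ] P × (ℝ × Ec d) :=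
    (ContinuousLinearMap.fst ..).prod ((0 : P × Ec d →L[ℝ] ℝ).prod (.snd ..))
  let ψ₀ : P × Ec d → P × Ec (d + 1) := g ∘ j
  set U := {a | g (h a) = a ∧ (∀ᶠ p in 𝓝 (h a), h (g p) = p) ∧
      (∀ α : I, ContDiffPointwiseHolderAt k α h a → ContDiffPointwiseHolderAt k α g (h a))}
  have hj : ∀ a ∈ A, j (π₀ a) = h a := by
    intro a ha
    have : l (f a) = 0 := by rw [hA a ha, map_zero]
    simp [j, π₀, h, this, Q]
  have hψ₀ : ∀ a ∈ A ∩ U, ψ₀ (π₀ a) = a := fun a ha ↦ by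
    change g (j (π₀ a)) = a
    rw [hj a ha.1, ha.2.1]
  have hψ₀d : ∀ a ∈ A ∩ U, ContDiffPointwiseHolderAt k α ψ₀ (π₀ a) := by
    intro a ha
    refine .comp _ ?_ j.contDiffPointwiseHolderAt hk
    rw [hj a ha.1]
    exact ha.2.2.2 α (hh a ha.1)
  have hψ₀fst : ∀ a ∈ A ∩ U, ∀ᶠ p in 𝓝 (π₀ a), (ψ₀ p).1 = p.1 := by
    intro a ha
    have h1 : Tendsto j (𝓝 (π₀ a)) (𝓝 (h a)) := by
      rw [← hj a ha.1]; exact j.continuous.tendsto _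
    filter_upwards [h1.eventually ha.2.2.1] with p hp
    exact congrArg Prod.fst hp
  obtain ⟨S, hSc, hS, hSA⟩ := ih (f ∘ ψ₀) (π₀ '' (A ∩ U))
    (by
      rintro _ ⟨a, ha, rfl⟩
      refine .comp _ ?_ (hψ₀d a ha) hk
      rw [hψ₀ a ha]; exact hf a ha.1)
    (by
      rintro _ ⟨a, ha, rfl⟩
      rw [Function.comp_apply, hψ₀ a ha, hA a ha.1])
  refine ⟨A ∩ U, inter_mem self_mem_nhdsWithin (mem_nhdsWithin_of_mem_nhds hg),
    (fun B ↦ A ∩ U ∩ π₀ ⁻¹' B) '' S, hSc.image _, ?_, ?_⟩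
  · rintro _ ⟨B, hB, rfl⟩
    obtain ⟨d', ψ, π, hψπ⟩ := hS B hB
    refine ⟨d', ψ₀ ∘ ψ, π ∘ π₀, ?_⟩
    rintro a ⟨ha, haB⟩
    obtain ⟨h1, h2, h3, h4, h5⟩ := hψπ (π₀ a) haB
    refine ⟨h1.comp a π₀.contDiff.contDiffAt, ?_, ?_, ?_, h5⟩
    · simp only [Function.comp_apply]
      rw [h2, hψ₀ a ha]
    · refine ContDiffAt.comp (π (π₀ a)) ?_ h3
      rw [h2]
      exact (hψ₀d a ha).contDiffAt.of_le (mod_cast Nat.one_le_iff_ne_zero.2 hk)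
    · have h6 : Tendsto ψ (𝓝 (π (π₀ a))) (𝓝 (π₀ a)) := by
        simpa only [h2] using h3.continuousAt.tendsto
      filter_upwards [h4, h6.eventually (hψ₀fst a ha)] with p hp hp'
      exact hp'.trans hp
  · intro a ha
    obtain ⟨B, hB, haB⟩ := hSA ⟨a, ha, rfl⟩
    exact ⟨_, ⟨B, hB, rfl⟩, ha, haB⟩

/-- The zeros of a function of class `C^{k+(α)}` are covered by countably many pieces of fiberwise
`C¹` submanifolds along which the function is of order `k + α`. -/
theorem isCountablyFlat_of_contDiffPointwiseHolderAt [FiniteDimensional ℝ P] (k : ℕ)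
    (α : unitInterval) : ∀ {W : Type} [NormedAddCommGroup W] [NormedSpace ℝ W] (d : ℕ)
      (f : P × Ec d → W) (A : Set (P × Ec d)),
      (∀ a ∈ A, ContDiffPointwiseHolderAt k α f a) → (∀ a ∈ A, f a = 0) →
      IsCountablyFlat (k + α) f A := by
  induction k with
  | zero =>
    intro W _ _ d f A hf hA
    refine ⟨{A}, countable_singleton _, ?_, by simp⟩
    rintro _ rfl
    refine ⟨d, id, id, fun a ha ↦ ⟨contDiffAt_id, rfl, contDiffAt_id, .of_forall fun _ ↦ rfl, ?_⟩⟩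
    have h1 : Tendsto (fun v ↦ (a.1, v)) (𝓝 a.2) (𝓝 a) := (Continuous.prodMk_right a.1).tendsto a.2
    have h2 := (ContDiffPointwiseHolderAt.zero_order_iff.1 (hf a ha)).2.comp_tendsto h1
    refine h2.congr (fun v ↦ ?_) fun v ↦ ?_
    · simp [hA a ha]
    · simp [Prod.norm_def]
  | succ k ih =>
    intro W _ _ d
    induction d with
    | zero =>
      intro f A hf hA
      refine ⟨{A}, countable_singleton _, ?_, by simp⟩
      rintro _ rfl
      refine ⟨0, id, id, fun a ha ↦ ⟨contDiffAt_id, rfl, contDiffAt_id, .of_forall fun _ ↦ rfl, ?_⟩⟩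
      have : (fun v ↦ f (id ((id a).1, v))) = fun _ ↦ 0 := by
        ext1 v
        rw [← hA a ha]
        exact congrArg f (Prod.ext rfl (Subsingleton.elim _ _))
      rw [this]
      exact isBigO_zero _ _
    | succ d ihd =>
      intro f A hf hA
      let D : P × Ec (d + 1) → Ec (d + 1) →L[ℝ] W :=
        fun p ↦ (fderiv ℝ f p).comp (.inr ℝ P (Ec (d + 1)))
      have hD : ∀ a ∈ A, ContDiffPointwiseHolderAt k α D a := fun a ha ↦
        ((hf a ha).fderiv k.lt_succ_self).continuousLinearMap_comp
          (ContinuousLinearMap.precomp W (.inr ℝ P (Ec (d + 1))))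
      have h1 : IsCountablyFlat (↑(k + 1) + α) f {a ∈ A | D a = 0} := by
        obtain ⟨S, hSc, hS, hSA⟩ := ih (d + 1) D {a ∈ A | D a = 0}
          (fun a ha ↦ hD a ha.1) (fun a ha ↦ ha.2)
        refine ⟨(fun B ↦ A ∩ B) '' S, hSc.image _, ?_, ?_⟩
        · rintro _ ⟨B, hB, rfl⟩
          obtain ⟨d', ψ, π, hψπ⟩ := hS B hB
          refine ⟨d', ψ, π, ?_⟩
          rintro a ⟨ha, haB⟩
          obtain ⟨h1, h2, h3, h4, h5⟩ := hψπ a haB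
          refine ⟨h1, h2, h3, h4, ?_⟩
          have := isBigO_sub_of_fderiv_comp_inr (add_nonneg k.cast_nonneg α.2.1)
            (by rw [h2]; exact (hf a ha).contDiffAt.of_le (by simp)) h3 h4 h5
          simp only [h2, hA a ha, sub_zero] at this
          have e : ((k + 1 : ℕ) : ℝ) + (α : ℝ) = k + α + 1 := by push_cast; ring
          rw [e]
          exact this
        · intro a ha
          obtain ⟨B, hB, haB⟩ := hSA ha
          exact ⟨_, ⟨B, hB, rfl⟩, ha.1, haB⟩
      have h2 : IsCountablyFlat (↑(k + 1) + α) f {a ∈ A | D a ≠ 0} :=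
        .of_locally fun a ha ↦ exists_nhds_isCountablyFlat_of_fderiv_comp_inr_ne_zero
          k.succ_ne_zero ihd (fun a ha ↦ hf a ha.1) (fun a ha ↦ hA a ha.1) ha ha.2
      refine (h1.union h2).mono fun a ha ↦ ?_
      by_cases h : D a = 0
      exacts [.inl ⟨ha, h⟩, .inr ⟨ha, h⟩]

end Decomposition

section Measure

/-- The set of points over a closed ball that are vertically `r`-close to a continuous graph. -/
theorem volume_tube_le {ν q : ℕ} (γ : Ec ν → Ec q) (x : Ec ν) {δ r : ℝ} (hδ : 0 ≤ δ) (hr : 0 ≤ r)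
    (hγ : ContinuousOn γ (closedBall x δ)) :
    volume {z : Ec ν × Ec q | z.1 ∈ closedBall x δ ∧ dist z.2 (γ z.1) ≤ r} ≤
      ENNReal.ofReal (δ ^ ν) * ENNReal.ofReal (r ^ q) *
        (volume (ball (0 : Ec ν) 1) * volume (ball (0 : Ec q) 1)) := by
  have hcont : ContinuousOn (fun z : Ec ν × Ec q ↦ dist z.2 (γ z.1))
      (Prod.fst ⁻¹' closedBall x δ) :=
    continuous_dist.comp_continuousOn (continuousOn_snd.prodMk
      (hγ.comp continuousOn_fst fun _ h ↦ h))
  have hclosed : IsClosed {z : Ec ν × Ec q | z.1 ∈ closedBall x δ ∧ dist z.2 (γ z.1) ≤ r} :=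
    hcont.preimage_isClosed_of_isClosed (isClosed_closedBall.preimage continuous_fst) isClosed_Iic
  rw [Measure.volume_eq_prod, Measure.prod_apply hclosed.measurableSet]
  calc ∫⁻ y, volume (Prod.mk y ⁻¹' {z : Ec ν × Ec q | z.1 ∈ closedBall x δ ∧ dist z.2 (γ z.1) ≤ r})
      ≤ ∫⁻ y, (closedBall x δ).indicator
          (fun _ ↦ ENNReal.ofReal (r ^ q) * volume (ball (0 : Ec q) 1)) y := by
        refine lintegral_mono fun y ↦ ?_
        by_cases hy : y ∈ closedBall x δ
        · rw [indicator_of_mem hy]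
          refine (measure_mono (t := closedBall (γ y) r) fun w hw ↦ hw.2).trans_eq ?_
          rw [Measure.addHaar_closedBall _ _ hr, finrank_euclideanSpace_fin]
        · have : Prod.mk y ⁻¹' {z : Ec ν × Ec q | z.1 ∈ closedBall x δ ∧ dist z.2 (γ z.1) ≤ r}
            = ∅ := eq_empty_of_forall_notMem fun w hw ↦ hy hw.1
          rw [this, measure_empty]
          exact zero_le
    _ = _ := by
        rw [lintegral_indicator isClosed_closedBall.measurableSet, setLIntegral_const,
          Measure.addHaar_closedBall _ _ hδ, finrank_euclideanSpace_fin]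
        ring

/-- If the image of every set of small diameter under `F` has measure at most a multiple of the
`s`-th power of the diameter, then `F` maps `μH[s]`-null sets to null sets. -/
theorem measure_image_eq_zero_of_ediam_le {X Y : Type*} [MetricSpace X] [MeasurableSpace X]
    [BorelSpace X] [MeasurableSpace Y] {μ : Measure Y} {F : X → Y} {B : Set X} {s : ℝ} {C : ℝ≥0}
    {r : ℝ≥0∞} (hr : 0 < r)
    (h : ∀ S, ediam S ≤ r → μ (F '' (S ∩ B)) ≤ C * ediam S ^ s) (hB : μH[s] B = 0) :
    μ (F '' B) = 0 := by
  have hC : C + 1 ≠ 0 := by positivity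
  let m : OuterMeasure X := OuterMeasure.restrict B (OuterMeasure.comap F μ.toOuterMeasure)
  have hm : ∀ S, m S = μ (F '' (S ∩ B)) := fun S ↦ by simp [m]
  have h1 : m ≤ OuterMeasure.mkMetric ((C + 1) • fun x : ℝ≥0∞ ↦ x ^ s) := by
    refine OuterMeasure.le_mkMetric _ m r hr fun S hS ↦ ?_
    rw [hm]
    refine (h S hS).trans ?_
    simp only [Pi.smul_apply, ENNReal.smul_def, smul_eq_mul]
    gcongr
    simp
  rw [OuterMeasure.mkMetric_nnreal_smul _ hC] at h1
  have h2 := h1 B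
  rw [hm, inter_self] at h2
  refine le_antisymm (h2.trans_eq ?_) zero_le
  have h3 : OuterMeasure.mkMetric (fun x : ℝ≥0∞ ↦ x ^ s) B = 0 := by
    rwa [Measure.hausdorffMeasure, ← Measure.coe_toOuterMeasure,
      Measure.mkMetric_toOuterMeasure] at hB
  rw [smul_apply, h3, smul_zero]

/-- A map that is `C¹` at all points of `B` maps `μH[s]`-null subsets of `B` to null sets. -/
theorem hausdorffMeasure_image_eq_zero_of_contDiffAt {X Y : Type*} [NormedAddCommGroup X]
    [NormedSpace ℝ X] [FiniteDimensional ℝ X] [MeasurableSpace X] [BorelSpace X]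
    [NormedAddCommGroup Y] [NormedSpace ℝ Y] [MeasurableSpace Y] [BorelSpace Y]
    {F : X → Y} {B : Set X} {s : ℝ} (hs : 0 ≤ s) (hF : ∀ x ∈ B, ContDiffAt ℝ 1 F x)
    (hB : μH[s] B = 0) : μH[s] (F '' B) = 0 := by
  have := FiniteDimensional.proper ℝ X
  have hloc : ∀ x ∈ B, ∃ t ∈ 𝓝[B] x, μH[s] (F '' t) = 0 := by
    intro x hx
    obtain ⟨K, t, ht, hK⟩ := (hF x hx).exists_lipschitzOnWith
    refine ⟨t ∩ B, inter_mem (mem_nhdsWithin_of_mem_nhds ht) self_mem_nhdsWithin, ?_⟩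
    refine le_antisymm (((hK.mono inter_subset_left).hausdorffMeasure_image_le hs).trans_eq ?_)
      zero_le
    rw [measure_mono_null inter_subset_right hB, mul_zero]
  have hL : IsLindelof B := HereditarilyLindelofSpace.isLindelof B
  refine hL.induction_on (p := fun t ↦ μH[s] (F '' t) = 0)
    (fun _ _ hst ht ↦ measure_mono_null (image_mono hst) ht) (fun S hS h ↦ ?_) hloc
  rw [sUnion_eq_biUnion, image_iUnion₂]
  exact (measure_biUnion_null_iff hS).2 h

/-- Let `Ψ` be a map over `ℝ^ν` whose variation along the fibers at the points of `B` is uniformly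
of order `s`. Then `Ψ` maps `B` to a null set provided that `B` has vanishing measure in the
corresponding dimension. -/
theorem volume_image_eq_zero_of_norm_sub_fiber_le {ν q d : ℕ} {s K ε : ℝ} (hs : 0 ≤ s) (hK : 0 ≤ K)
    (hε0 : 0 < ε) {Ψ : Ec ν × Ec d → Ec ν × Ec q} {B : Set (Ec ν × Ec d)}
    (hc : ∀ b ∈ B, ∀ p ∈ ball b ε, ContinuousAt Ψ p) (hfst : ∀ b ∈ B, (Ψ b).1 = b.1)
    (hO : ∀ b ∈ B, ∀ v ∈ ball b.2 ε, ‖Ψ (b.1, v) - Ψ b‖ ≤ K * ‖v - b.2‖ ^ s)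
    (hB : μH[(ν : ℝ) + s * q] B = 0) : volume (Ψ '' B) = 0 := by
  let c : ℝ≥0∞ := ENNReal.ofReal (K ^ q) *
    (volume (ball (0 : Ec ν) 1) * volume (ball (0 : Ec q) 1))
  have hctop : c ≠ ∞ := ENNReal.mul_ne_top ENNReal.ofReal_ne_top
    (ENNReal.mul_ne_top measure_ball_lt_top.ne measure_ball_lt_top.ne)
  refine measure_image_eq_zero_of_ediam_le (C := c.toNNReal) (r := ENNReal.ofReal (ε / 2))
    (by simpa using hε0) (fun S hS ↦ ?_) hB
  rw [ENNReal.coe_toNNReal hctop]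
  obtain hemp | ⟨b₀, hb₀S, hb₀⟩ := (S ∩ B).eq_empty_or_nonempty
  · simp [hemp]
  set δ := diam S with hδ
  have hδ0 : 0 ≤ δ := diam_nonneg
  have hStop : ediam S ≠ ∞ := ne_top_of_le_ne_top ENNReal.ofReal_ne_top hS
  have hSb : Bornology.IsBounded S := isBounded_iff_ediam_ne_top.2 hStop
  have hδε : δ < ε := lt_of_le_of_lt (ENNReal.toReal_le_of_le_ofReal (by positivity) hS)
    (half_lt_self hε0)
  have hsub : Ψ '' (S ∩ B) ⊆ {z : Ec ν × Ec q | z.1 ∈ closedBall b₀.1 δ ∧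
      dist z.2 ((fun x ↦ (Ψ (x, b₀.2)).2) z.1) ≤ K * δ ^ s} := by
    rintro _ ⟨b, ⟨hbS, hb⟩, rfl⟩
    have hdist : dist b b₀ ≤ δ := dist_le_diam_of_mem hSb hbS hb₀S
    have h1 : dist b.1 b₀.1 ≤ δ := (le_max_left _ _).trans hdist
    have h2 : dist b₀.2 b.2 ≤ δ := by
      rw [dist_comm]; exact (le_max_right _ _).trans hdist
    refine ⟨by rw [hfst b hb]; exact h1, ?_⟩
    simp only [hfst b hb]
    rw [dist_comm, dist_eq_norm]
    refine (norm_snd_le (Ψ (b.1, b₀.2) - Ψ b)).trans ((hO b hb b₀.2 (h2.trans_lt hδε)).trans ?_)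
    rw [← dist_eq_norm]
    gcongr
  refine (measure_mono hsub).trans ((volume_tube_le (fun x ↦ (Ψ (x, b₀.2)).2) b₀.1 hδ0
    (by positivity) ?_).trans_eq ?_)
  · intro x hx
    have hmem : (x, b₀.2) ∈ ball b₀ ε := by
      rw [mem_ball, Prod.dist_eq, dist_self]
      exact max_lt (lt_of_le_of_lt hx hδε) hε0
    have h3 : ContinuousAt Ψ (x, b₀.2) := hc b₀ hb₀ _ hmem
    have h4 : ContinuousAt (fun y ↦ (y, b₀.2)) x := by fun_prop
    have h5 : ContinuousAt (fun y ↦ Ψ (y, b₀.2)) x := ContinuousAt.comp h3 h4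
    exact (continuousAt_snd.comp h5).continuousWithinAt
  · have h5 : ediam S = ENNReal.ofReal δ := (ENNReal.ofReal_toReal hStop).symm
    have h6 : δ ^ ν * (K * δ ^ s) ^ q = K ^ q * δ ^ ((ν : ℝ) + s * q) := by
      rw [Real.rpow_add_of_nonneg hδ0 (by positivity) (by positivity), Real.rpow_natCast,
        Real.rpow_mul hδ0, Real.rpow_natCast]
      ring
    rw [h5, ENNReal.ofReal_rpow_of_nonneg hδ0 (by positivity), ← ENNReal.ofReal_mul (by positivity),
      h6, ENNReal.ofReal_mul (by positivity)]
    exact mul_right_comm _ _ _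

/-- Let `Ψ` be a map over `ℝ^ν` whose variation along the fibers at the points of `B` is of order
`s`. Then `Ψ` maps `B` to a null set provided that `B` has vanishing measure in the corresponding
dimension. -/
theorem volume_image_eq_zero_of_isBigO_fiber {ν q d : ℕ} {s : ℝ} (hs : 0 ≤ s)
    {Ψ : Ec ν × Ec d → Ec ν × Ec q} {B : Set (Ec ν × Ec d)}
    (hc : ∀ b ∈ B, ∀ᶠ p in 𝓝 b, ContinuousAt Ψ p) (hfst : ∀ b ∈ B, (Ψ b).1 = b.1)
    (hO : ∀ b ∈ B, (fun v ↦ Ψ (b.1, v) - Ψ b) =O[𝓝 b.2] (fun v ↦ ‖v - b.2‖ ^ s))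
    (hB : μH[(ν : ℝ) + s * q] B = 0) : volume (Ψ '' B) = 0 := by
  let BN : ℕ → Set (Ec ν × Ec d) := fun N ↦ {b ∈ B |
    (∀ p ∈ ball b (1 / (N + 1 : ℝ)), ContinuousAt Ψ p) ∧
    ∀ v ∈ ball b.2 (1 / (N + 1 : ℝ)), ‖Ψ (b.1, v) - Ψ b‖ ≤ N * ‖v - b.2‖ ^ s}
  have hcover : B ⊆ ⋃ N, BN N := by
    intro b hb
    obtain ⟨ε₁, hε₁, h₁⟩ := Metric.eventually_nhds_iff_ball.1 (hc b hb)
    obtain ⟨C, hC⟩ := (hO b hb).bound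
    obtain ⟨ε₂, hε₂, h₂⟩ := Metric.eventually_nhds_iff_ball.1 hC
    obtain ⟨N₁, hN₁⟩ := exists_nat_one_div_lt hε₁
    obtain ⟨N₂, hN₂⟩ := exists_nat_one_div_lt hε₂
    obtain ⟨N₃, hN₃⟩ := exists_nat_ge C
    let N := max (max N₁ N₂) N₃
    have e₁ : 1 / (N + 1 : ℝ) ≤ 1 / (N₁ + 1 : ℝ) :=
      Nat.one_div_le_one_div (le_max_of_le_left (le_max_left _ _))
    have e₂ : 1 / (N + 1 : ℝ) ≤ 1 / (N₂ + 1 : ℝ) :=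
      Nat.one_div_le_one_div (le_max_of_le_left (le_max_right _ _))
    have e₃ : C ≤ N := hN₃.trans (mod_cast le_max_right _ _)
    refine mem_iUnion.2 ⟨N, hb, fun p hp ↦ h₁ p (ball_subset_ball (e₁.trans hN₁.le) hp),
      fun v hv ↦ (h₂ v (ball_subset_ball (e₂.trans hN₂.le) hv)).trans ?_⟩
    rw [Real.norm_of_nonneg (by positivity)]
    gcongr
  refine measure_mono_null (image_mono hcover) ?_
  rw [image_iUnion, measure_iUnion_null_iff]
  intro N
  exact volume_image_eq_zero_of_norm_sub_fiber_le hs N.cast_nonneg Nat.one_div_pos_of_nat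
    (fun b hb ↦ hb.2.1) (fun b hb ↦ hfst b hb.1) (fun b hb ↦ hb.2.2)
    (measure_mono_null (fun b hb ↦ hb.1) hB)

end Measure

section CriticalSet

theorem measure_eq_zero_of_image_equiv {V W : Type*} [NormedAddCommGroup V] [NormedSpace ℝ V]
    [FiniteDimensional ℝ V] [MeasurableSpace V] [BorelSpace V] [NormedAddCommGroup W]
    [NormedSpace ℝ W] [FiniteDimensional ℝ W] [MeasurableSpace W] [BorelSpace W]
    {μ : Measure V} [μ.IsAddHaarMeasure] {ρ : Measure W} [ρ.IsAddHaarMeasure] (L : V ≃L[ℝ] W)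
    {s : Set V} (hs : ρ (L '' s) = 0) : μ s = 0 := by
  have h1 := Measure.isAddLeftInvariant_eq_smul (μ.map L) ρ
  have h2 : μ.map L (L '' s) = μ s := by
    refine (L.toHomeomorph.measurableEmbedding.map_apply μ _).trans ?_
    exact congrArg μ (preimage_image_eq _ L.injective)
  rw [← h2, h1, Measure.smul_apply, hs, smul_zero]

theorem exists_surjective_comp_of_finrank_range {V W : Type*} [NormedAddCommGroup V]
    [NormedSpace ℝ V] [NormedAddCommGroup W] [NormedSpace ℝ W] [FiniteDimensional ℝ W]
    (D : V →L[ℝ] W) {ν : ℕ} (hν : Module.finrank ℝ (LinearMap.range (D : V →ₗ[ℝ] W)) = ν) :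
    ∃ T : W →L[ℝ] Ec ν, Function.Surjective (T.comp D) := by
  let φ : LinearMap.range (D : V →ₗ[ℝ] W) ≃ₗ[ℝ] Ec ν := LinearEquiv.ofFinrankEq _ _ (by simp [hν])
  obtain ⟨p, hp⟩ := (LinearMap.range (D : V →ₗ[ℝ] W)).subtype.exists_leftInverse_of_injective
    (Submodule.ker_subtype _)
  refine ⟨((φ : _ →ₗ[ℝ] Ec ν) ∘ₗ p).toContinuousLinearMap, fun y ↦ ?_⟩
  obtain ⟨v, hv⟩ := (φ.symm y).2
  refine ⟨v, ?_⟩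
  have h1 : p (D v) = φ.symm y := by
    have := LinearMap.congr_fun hp (φ.symm y)
    simpa [← hv] using this
  simp [h1]

theorem apply_eq_zero_of_surjective_comp {V W U : Type*} [AddCommGroup V] [Module ℝ V]
    [AddCommGroup W] [Module ℝ W] [FiniteDimensional ℝ W] [AddCommGroup U] [Module ℝ U]
    [FiniteDimensional ℝ U] {D : V →ₗ[ℝ] W} {T : W →ₗ[ℝ] U} (hTD : Function.Surjective (T ∘ₗ D))
    (hD : Module.finrank ℝ (LinearMap.range D) = Module.finrank ℝ U) {v : V} (hv : T (D v) = 0) :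
    D v = 0 := by
  have hsurj : Function.Surjective (T.domRestrict (LinearMap.range D)) := fun y ↦
    let ⟨w, hw⟩ := hTD y
    ⟨⟨D w, w, rfl⟩, hw⟩
  have hinj := (LinearMap.injective_iff_surjective_of_finrank_eq_finrank hD).2 hsurj
  have h0 : (⟨D v, v, rfl⟩ : LinearMap.range D) = 0 := hinj (by simpa using hv)
  exact congrArg Subtype.val h0

/-- Let `G` be a map over `ℝ^ν` of class `C^{k+1+(α)}` whose fiberwise derivative vanishes on `A`.
Then `G` maps `A` to a null set provided that `A` has vanishing measure in the corresponding
dimension. -/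
theorem volume_image_eq_zero_of_fderiv_comp_inr_eq_zero {ν d q k : ℕ} {α : unitInterval}
    {G : Ec ν × Ec d → Ec ν × Ec q} {A : Set (Ec ν × Ec d)}
    (hG : ∀ a ∈ A, ContDiffPointwiseHolderAt (k + 1) α G a)
    (hfst : ∀ a ∈ A, (G a).1 = a.1)
    (hD : ∀ a ∈ A, (fderiv ℝ G a).comp (.inr ℝ (Ec ν) (Ec d)) = 0)
    (hA : μH[(ν : ℝ) + (k + α + 1) * q] A = 0) : volume (G '' A) = 0 := by
  have hs : 0 ≤ (k : ℝ) + α := add_nonneg k.cast_nonneg α.2.1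
  have hs' : 0 ≤ (k : ℝ) + α + 1 := by linarith
  obtain ⟨S, hSc, hS, hSA⟩ := isCountablyFlat_of_contDiffPointwiseHolderAt k α d
    (fun p ↦ (fderiv ℝ G p).comp (.inr ℝ (Ec ν) (Ec d))) A
    (fun a ha ↦ ((hG a ha).fderiv k.lt_succ_self).continuousLinearMap_comp
      (ContinuousLinearMap.precomp (Ec ν × Ec q) (.inr ℝ (Ec ν) (Ec d)))) hD
  have hcover : G '' A ⊆ ⋃ B ∈ S, G '' (A ∩ B) := by
    rintro _ ⟨a, ha, rfl⟩
    obtain ⟨B, hB, haB⟩ := hSA ha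
    exact mem_biUnion hB ⟨a, ⟨ha, haB⟩, rfl⟩
  refine measure_mono_null hcover ((measure_biUnion_null_iff hSc).2 fun B hB ↦ ?_)
  obtain ⟨d', ψ, π, hψπ⟩ := hS B hB
  have hC1 : ∀ a ∈ A, ContDiffAt ℝ 1 G a := fun a ha ↦ (hG a ha).contDiffAt.of_le (by simp)
  have hsub : G '' (A ∩ B) ⊆ (G ∘ ψ) '' (π '' (A ∩ B)) := by
    rintro _ ⟨a, ha, rfl⟩
    exact ⟨π a, ⟨a, ha, rfl⟩, congrArg G (hψπ a ha.2).2.1⟩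
  refine measure_mono_null hsub (volume_image_eq_zero_of_isBigO_fiber hs' ?_ ?_ ?_ ?_)
  · rintro _ ⟨a, ⟨ha, haB⟩, rfl⟩
    obtain ⟨h1, h2, h3, h4, h5⟩ := hψπ a haB
    have : ContDiffAt ℝ 1 (G ∘ ψ) (π a) := ContDiffAt.comp (π a) (by rw [h2]; exact hC1 a ha) h3
    exact (this.eventually (by simp)).mono fun p hp ↦ hp.continuousAt
  · rintro _ ⟨a, ⟨ha, haB⟩, rfl⟩
    obtain ⟨h1, h2, h3, h4, h5⟩ := hψπ a haB
    rw [← h4.self_of_nhds, Function.comp_apply, h2, hfst a ha]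
  · rintro _ ⟨a, ⟨ha, haB⟩, rfl⟩
    obtain ⟨h1, h2, h3, h4, h5⟩ := hψπ a haB
    exact isBigO_sub_of_fderiv_comp_inr hs (by rw [h2]; exact hC1 a ha) h3 h4 h5
  · exact hausdorffMeasure_image_eq_zero_of_contDiffAt (by positivity)
      (fun a ha ↦ (hψπ a ha.2).1) (measure_mono_null inter_subset_left hA)

theorem exists_nhdsWithin_volume_image_eq_zero {n m ν k : ℕ} {α : unitInterval}
    {f : Ec n → Ec m} {A : Set (Ec n)} (hν : ν ≤ m)
    (hf : ∀ a ∈ A, ContDiffPointwiseHolderAt (k + 1) α f a) (hr : ∀ a ∈ A, derivRank f a = ν)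
    (hA : μH[(ν : ℝ) + (k + α + 1) * (m - ν : ℕ)] A = 0) {a₀ : Ec n} (ha₀ : a₀ ∈ A) :
    ∃ t ∈ 𝓝[A] a₀, volume (f '' t) = 0 := by
  have hs : 0 ≤ (k : ℝ) + α + 1 := add_nonneg (add_nonneg k.cast_nonneg α.2.1) zero_le_one
  have hfd : ∀ a ∈ A, HasFDerivAt f (fderiv ℝ f a) a := fun a ha ↦
    ((hf a ha).differentiableAt k.succ_ne_zero).hasFDerivAt
  obtain ⟨T, hT⟩ := exists_surjective_comp_of_finrank_range (fderiv ℝ f a₀) (hr a₀ ha₀)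
  have hνn : ν ≤ n := by
    have := LinearMap.finrank_le_finrank_of_surjective (f := (T.comp (fderiv ℝ f a₀)).toLinearMap) hT
    simpa using this
  obtain ⟨e, he⟩ := exists_equiv_prod_of_surjective T (Function.Surjective.of_comp hT)
    (d := m - ν) (by simp [hν])
  obtain ⟨L, hL⟩ := exists_equiv_prod_of_surjective (T.comp (fderiv ℝ f a₀)) hT
    (d := n - ν) (by simp [hνn])
  let q : Ec n →L[ℝ] Ec (n - ν) :=
    (ContinuousLinearMap.snd ℝ (Ec ν) (Ec (n - ν))).comp L.toContinuousLinearMap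
  let h : Ec n → Ec ν × Ec (n - ν) := fun x ↦ (T (f x), q x)
  have hh : ∀ a ∈ A, ContDiffPointwiseHolderAt (k + 1) α h a := fun a ha ↦
    ((hf a ha).continuousLinearMap_comp T).prodMk q.contDiffPointwiseHolderAt
  have hhd : ∀ a ∈ A, HasFDerivAt h ((T.comp (fderiv ℝ f a)).prod q) a := fun a ha ↦
    (T.hasFDerivAt.comp a (hfd a ha)).prodMk q.hasFDerivAt
  have hinj : Function.Injective (fderiv ℝ h a₀) := by
    rw [(hhd a₀ ha₀).fderiv, injective_iff_map_eq_zero]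
    intro v hv
    refine L.map_eq_zero_iff.1 (Prod.ext ((hL v).trans (congrArg Prod.fst hv)) ?_)
    have hv₂ : q v = 0 := congrArg Prod.snd hv
    exact hv₂
  obtain ⟨g, hg⟩ := (hh a₀ ha₀).contDiffAt.exists_local_leftInverse k.succ_ne_zero hinj
    (by simp [hνn])
  set U := {a | g (h a) = a ∧ (∀ᶠ p in 𝓝 (h a), h (g p) = p) ∧
      (∀ α : I, ContDiffPointwiseHolderAt (k + 1) α h a →
        ContDiffPointwiseHolderAt (k + 1) α g (h a))}
  refine ⟨A ∩ U, inter_mem self_mem_nhdsWithin (mem_nhdsWithin_of_mem_nhds hg), ?_⟩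
  have hgd : ∀ a ∈ A ∩ U, ContDiffPointwiseHolderAt (k + 1) α g (h a) := fun a ha ↦
    ha.2.2.2 α (hh a ha.1)
  have hfg : ∀ a ∈ A ∩ U, ContDiffPointwiseHolderAt (k + 1) α (f ∘ g) (h a) := fun a ha ↦
    .comp _ (by rw [ha.2.1]; exact hf a ha.1) (hgd a ha) k.succ_ne_zero
  have : (volume : Measure (Ec ν × Ec (m - ν))).IsAddHaarMeasure :=
    Measure.prod.instIsAddHaarMeasure volume volume
  refine measure_eq_zero_of_image_equiv (ρ := volume) e (measure_mono_null ?_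
    (volume_image_eq_zero_of_fderiv_comp_inr_eq_zero (k := k) (α := α) (G := e ∘ (f ∘ g))
      (A := h '' (A ∩ U)) ?_ ?_ ?_ ?_))
  · rintro _ ⟨_, ⟨a, ha, rfl⟩, rfl⟩
    exact ⟨h a, ⟨a, ha, rfl⟩, by simp [ha.2.1]⟩
  · rintro _ ⟨a, ha, rfl⟩
    exact (hfg a ha).continuousLinearMap_comp e.toContinuousLinearMap
  · rintro _ ⟨a, ha, rfl⟩
    simp [ha.2.1, he, h]
  · rintro _ ⟨a, ha, rfl⟩
    have hg' : HasFDerivAt g (fderiv ℝ g (h a)) (h a) :=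
      ((hgd a ha).differentiableAt k.succ_ne_zero).hasFDerivAt
    have hhg : ((T.comp (fderiv ℝ f a)).prod q).comp (fderiv ℝ g (h a)) = .id ℝ _ := by
      have h1 : HasFDerivAt h ((T.comp (fderiv ℝ f a)).prod q) (g (h a)) := by
        rw [ha.2.1]; exact hhd a ha.1
      exact (h1.comp (h a) hg').unique ((hasFDerivAt_id (h a)).congr_of_eventuallyEq ha.2.2.1)
    have hfst : ∀ w, T (fderiv ℝ f a (fderiv ℝ g (h a) w)) = w.1 := fun w ↦
      congrArg Prod.fst (DFunLike.congr_fun hhg w)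
    have hG : HasFDerivAt (e ∘ (f ∘ g))
        (e.toContinuousLinearMap.comp ((fderiv ℝ f a).comp (fderiv ℝ g (h a)))) (h a) := by
      have h1 : HasFDerivAt f (fderiv ℝ f a) (g (h a)) := by rw [ha.2.1]; exact hfd a ha.1
      exact e.toContinuousLinearMap.hasFDerivAt.comp (h a) (h1.comp (h a) hg')
    rw [hG.fderiv]
    ext1 w
    have h0 : fderiv ℝ f a (fderiv ℝ g (h a) (0, w)) = 0 :=
      apply_eq_zero_of_surjective_comp (D := (fderiv ℝ f a).toLinearMap) (T := T.toLinearMap)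
        (fun y ↦ ⟨fderiv ℝ g (h a) (y, 0), hfst _⟩) (by simpa [derivRank] using hr a ha.1)
        (hfst (0, w))
    simp [h0]
  · exact hausdorffMeasure_image_eq_zero_of_contDiffAt (by positivity)
      (fun a ha ↦ (hh a ha.1).contDiffAt.of_le (by simp)) (measure_mono_null inter_subset_left hA)

/-- A set of points at which the derivative has rank `ν` is mapped to a null set provided that it
has vanishing measure in the corresponding dimension. -/
theorem volume_image_eq_zero_of_derivRank_eq {n m ν k : ℕ} {α : unitInterval}
    {f : Ec n → Ec m} {A : Set (Ec n)} (hν : ν ≤ m)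
    (hf : ∀ a ∈ A, ContDiffPointwiseHolderAt (k + 1) α f a) (hr : ∀ a ∈ A, derivRank f a = ν)
    (hA : μH[(ν : ℝ) + (k + α + 1) * (m - ν : ℕ)] A = 0) : volume (f '' A) = 0 := by
  have hL : IsLindelof A := HereditarilyLindelofSpace.isLindelof A
  refine hL.induction_on (p := fun t ↦ volume (f '' t) = 0)
    (fun _ _ hst ht ↦ measure_mono_null (image_mono hst) ht) (fun S hS h ↦ ?_)
    fun a ha ↦ exists_nhdsWithin_volume_image_eq_zero hν hf hr hA ha
  rw [sUnion_eq_biUnion, image_iUnion₂]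
  exact (measure_biUnion_null_iff hS).2 h

end CriticalSet

end

/-- Norton, part i: if `f ∈ C^{k,t}(ℝⁿ;ℝᵐ)` and `E` is a subset of the
critical set `C_f = {x : rank Df(x) < m}` with `H^{k+t+m-1}(E) = 0`, then `Lᵐ(f(E)) = 0`. -/
theorem norton_part_i {n m k : ℕ} (hk : 1 ≤ k) (t : NNReal) (ht0 : 0 < t) (ht1 : t ≤ 1)
    (f : Ec n → Ec m) (hf : ContDiff ℝ k f)
    (hHolder : ∃ C : NNReal, HolderWith C t (iteratedFDeriv ℝ k f))
    (E : Set (Ec n)) (hE : E ⊆ {x | derivRank f x < m})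
    (hnull : μH[(k : ℝ) + t + m - 1] E = 0) :
    volume (f '' E) = 0 := by
  obtain ⟨k, rfl⟩ := Nat.exists_eq_succ_of_ne_zero (Nat.one_le_iff_ne_zero.1 hk)
  obtain ⟨C, hC⟩ := hHolder
  let α : unitInterval := ⟨t, t.2, ht1⟩
  have hα : ∀ a, ContDiffPointwiseHolderAt (k + 1) α f a := fun a ↦
    .of_contDiffOn_holderOnWith (s := univ) (C := C) hf.contDiffOn univ_mem (hC.holderOnWith _)
  have hcover : f '' E ⊆ ⋃ ν : Fin m, f '' {x ∈ E | derivRank f x = ν} := by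
    rintro _ ⟨x, hx, rfl⟩
    exact mem_iUnion.2 ⟨⟨_, hE hx⟩, x, ⟨hx, rfl⟩, rfl⟩
  refine measure_mono_null hcover (measure_iUnion_null fun ν ↦ ?_)
  refine volume_image_eq_zero_of_derivRank_eq ν.2.le (fun a _ ↦ hα a) (fun a ha ↦ ha.2) ?_
  refine le_antisymm ?_ zero_le
  refine (Measure.hausdorffMeasure_mono ?_ _).trans_eq (measure_mono_null (fun x hx ↦ hx.1) hnull)
  have h1 : (ν : ℝ) + 1 ≤ m := mod_cast ν.2
  have h2 : 0 ≤ (k : ℝ) + t := by positivity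
  have h3 : ((α : unitInterval) : ℝ) = t := rfl
  rw [Nat.cast_sub ν.2.le, h3]
  push_cast
  nlinarith [mul_nonneg h2 (sub_nonneg.2 h1)]

end
end

section
/- (Norton, part ii) Let k ≥ 1 be an integer and f: ℝⁿ → ℝᵐ of class C^k. If E is a subset of the critical set C_f = {x : rank Df(x) < m} and E is (k+m-1)-sigmafinite (a countable union of sets of finite H^{k+m-1} measure), then Lᵐ(f(E)) = 0. -/
open MeasureTheory Metric Filter Set

noncomputable section

open scoped Topology

/-- The Jacobian determinant of the map with coordinate functions `Φ i`. -/
def jac {n : ℕ} (Φ : Fin n → Ec n → ℝ) (x : Ec n) : ℝ :=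
  (Matrix.of fun i j => fderiv ℝ (Φ i) x (EuclideanSpace.single j 1)).det

lemma contDiff_jac {n k : ℕ} {Φ : Fin n → Ec n → ℝ}
    (hΦ : ∀ i, ContDiff ℝ (k + 1 : ℕ) (Φ i)) : ContDiff ℝ k (jac Φ) := by
  unfold jac
  simp only [Matrix.det_apply, Matrix.of_apply]
  refine ContDiff.sum fun σ _ => ContDiff.const_smul _ (contDiff_prod fun i _ => ?_)
  exact ((hΦ _).fderiv_right (by norm_cast)).clm_apply contDiff_const

lemma contDiff_update_family {n : ℕ} {k : WithTop ℕ∞} {Φ : Fin n → Ec n → ℝ} {f : Ec n → ℝ}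
    (hΦ : ∀ i, ContDiff ℝ k (Φ i)) (hf : ContDiff ℝ k f) (j i : Fin n) :
    ContDiff ℝ k (Function.update Φ j f i) := by
  rcases eq_or_ne i j with rfl | h
  · simpa using hf
  · simpa [h] using hΦ i

lemma sum_fderiv_single {n : ℕ} (g : Ec n → ℝ) (x w : Ec n) :
    ∑ j, fderiv ℝ g x (EuclideanSpace.single j 1) * w j = fderiv ℝ g x w := by
  have hw : w = ∑ j, w j • (EuclideanSpace.single j (1 : ℝ) : Ec n) := by
    simpa using ((EuclideanSpace.basisFun (Fin n) ℝ).sum_repr w).symm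
  conv_rhs => rw [hw]
  simp [mul_comm]

/-- Cramer's rule for the differential of `f` in the coordinates `Φ`. -/
lemma jac_mul_fderiv {n : ℕ} (Φ : Fin n → Ec n → ℝ) (f : Ec n → ℝ) (x w : Ec n) :
    jac Φ x * fderiv ℝ f x w =
      ∑ i, jac (Function.update Φ i f) x * fderiv ℝ (Φ i) x w := by
  set M : Matrix (Fin n) (Fin n) ℝ :=
    Matrix.of fun i j => fderiv ℝ (Φ i) x (EuclideanSpace.single j 1) with hM
  set b : Fin n → ℝ := fun j => fderiv ℝ f x (EuclideanSpace.single j 1) with hb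
  have hupd : ∀ i, jac (Function.update Φ i f) x = M.transpose.cramer b i := by
    intro i
    rw [Matrix.cramer_transpose_apply]
    unfold jac
    congr 1
    ext a c
    rcases eq_or_ne a i with rfl | h
    · simp [hb]
    · simp [h, hM]
  have key := Matrix.mulVec_cramer M.transpose b
  rw [Matrix.det_transpose] at key
  have h1 : jac Φ x * fderiv ℝ f x w = ∑ j, (M.det • b) j * w j := by
    rw [← sum_fderiv_single f x w, Finset.mul_sum]
    simp only [Pi.smul_apply, smul_eq_mul, mul_assoc]
    rfl
  rw [h1, ← key]
  simp only [hupd, ← sum_fderiv_single _ x w, Matrix.mulVec, dotProduct, Finset.mul_sum,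
    Finset.sum_mul]
  rw [Finset.sum_comm]
  refine Finset.sum_congr rfl fun i _ => Finset.sum_congr rfl fun j _ => ?_
  simp only [hM, Matrix.transpose_apply, Matrix.of_apply]
  ring

lemma surjective_of_jac_ne_zero {n : ℕ} {Φ : Fin n → Ec n → ℝ} {x : Ec n} (h : jac Φ x ≠ 0)
    (w : Fin n → ℝ) : ∃ v : Ec n, ∀ i, fderiv ℝ (Φ i) x v = w i := by
  set M : Matrix (Fin n) (Fin n) ℝ :=
    Matrix.of fun i j => fderiv ℝ (Φ i) x (EuclideanSpace.single j 1) with hM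
  have hu : IsUnit M.det := isUnit_iff_ne_zero.mpr h
  refine ⟨WithLp.toLp 2 (M⁻¹.mulVec w), fun i => ?_⟩
  rw [← sum_fderiv_single]
  have : M.mulVec (M⁻¹.mulVec w) = w := by
    rw [Matrix.mulVec_mulVec, Matrix.mul_nonsing_inv M hu, Matrix.one_mulVec]
  exact congrFun this i

lemma exists_local_inverse {n : ℕ} {Φ : Fin n → Ec n → ℝ} (hΦ : ∀ i, ContDiff ℝ 1 (Φ i))
    {x : Ec n} (h : jac Φ x ≠ 0) :
    ∃ θ : (Fin n → ℝ) → Ec n, ContDiffAt ℝ 1 θ (fun i => Φ i x) ∧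
      (∀ᶠ y in 𝓝 x, θ (fun i => Φ i y) = y) ∧
      ∀ᶠ z in 𝓝 (fun i => Φ i x), ∀ i, Φ i (θ z) = z i := by
  set F : Ec n → Fin n → ℝ := fun y i => Φ i y with hF
  have hFd : ContDiff ℝ 1 F := contDiff_pi.2 hΦ
  have hfd : ∀ v i, fderiv ℝ F x v i = fderiv ℝ (Φ i) x v := by
    intro v i
    rw [hF, fderiv_pi fun i => ((hΦ i).differentiable one_ne_zero).differentiableAt]
    rfl
  have hsurj : Function.Surjective (fderiv ℝ F x) := by
    intro w
    obtain ⟨v, hv⟩ := surjective_of_jac_ne_zero h w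
    exact ⟨v, funext fun i => by rw [hfd, hv]⟩
  have hinj : Function.Injective (fderiv ℝ F x) := by
    have := (LinearMap.injective_iff_surjective_of_finrank_eq_finrank
      (f := (fderiv ℝ F x : Ec n →ₗ[ℝ] Fin n → ℝ)) (by simp)).2 hsurj
    exact this
  let e : Ec n ≃L[ℝ] (Fin n → ℝ) :=
    (LinearEquiv.ofBijective (fderiv ℝ F x : Ec n →ₗ[ℝ] Fin n → ℝ)
      ⟨hinj, hsurj⟩).toContinuousLinearEquiv
  have he : HasFDerivAt F (e : Ec n →L[ℝ] Fin n → ℝ) x := by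
    have : (e : Ec n →L[ℝ] Fin n → ℝ) = fderiv ℝ F x := by ext v i; rfl
    rw [this]
    exact (hFd.differentiable one_ne_zero).differentiableAt.hasFDerivAt
  have hs := hFd.contDiffAt.hasStrictFDerivAt' he one_ne_zero
  refine ⟨hs.localInverse F e x, hFd.contDiffAt.to_localInverse he one_ne_zero,
    hs.eventually_left_inverse, ?_⟩
  filter_upwards [hs.eventually_right_inverse] with z hz i
  exact congrFun hz i

/-- If the partial derivatives of `f` in the coordinates `Φ` outside `J` vanish to order `k`
along the level sets of `(Ψ i)_{i ∈ J'}`, then `f` is constant to order `k + 1` along them. -/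
lemma eventually_abs_sub_le {n k : ℕ} {Φ Ψ : Fin n → Ec n → ℝ} (hΦ : ∀ i, ContDiff ℝ 1 (Φ i))
    (hΨ : ∀ i, ContDiff ℝ 1 (Ψ i)) {a : Ec n} (hΦa : jac Φ a ≠ 0) (hΨa : jac Ψ a ≠ 0)
    {J J' : Finset (Fin n)} (hJ : J ⊆ J') (hag : ∀ j ∈ J, Ψ j = Φ j)
    {f : Ec n → ℝ} (hf : ContDiff ℝ 1 f) {K : Set (Ec n)}
    (H : ∀ j, j ∉ J → ∀ ε > (0 : ℝ), ∀ᶠ p : Ec n × Ec n in 𝓝 (a, a), p.1 ∈ K →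
      (∀ i ∈ J', Ψ i p.2 = Ψ i p.1) →
      |jac (Function.update Φ j f) p.2| ≤ ε * ‖p.2 - p.1‖ ^ k) :
    ∀ ε > (0 : ℝ), ∀ᶠ p : Ec n × Ec n in 𝓝 (a, a), p.1 ∈ K →
      (∀ i ∈ J', Ψ i p.2 = Ψ i p.1) → |f p.2 - f p.1| ≤ ε * ‖p.2 - p.1‖ ^ (k + 1) := by
  intro ε hε
  set F : Ec n → Fin n → ℝ := fun y i => Ψ i y with hF
  have hFd : ContDiff ℝ 1 F := contDiff_pi.2 hΨ
  obtain ⟨θ, hθ, hleft, hright⟩ := exists_local_inverse hΨ hΨa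
  have hθa : θ (F a) = a := hleft.self_of_nhds
  obtain ⟨L₀, t, ht, hL₀⟩ := hFd.contDiffAt.exists_lipschitzOnWith (x := a)
  obtain ⟨L, hL, hLpos⟩ : ∃ L : ℝ, (L₀ : ℝ) ≤ L ∧ 0 < L :=
    ⟨L₀ + 1, by linarith, by positivity⟩
  obtain ⟨C, hC, hCpos⟩ : ∃ C : ℝ, ‖fderiv ℝ θ (F a)‖ < C ∧ 0 < C :=
    ⟨‖fderiv ℝ θ (F a)‖ + 1, by linarith, by positivity⟩
  obtain ⟨B, hB, hBpos⟩ : ∃ B : ℝ, (∀ i, ‖fderiv ℝ (Φ i) a‖ < B) ∧ 0 < B := by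
    refine ⟨∑ i, ‖fderiv ℝ (Φ i) a‖ + 1, fun i => ?_, by positivity⟩
    have := Finset.single_le_sum (f := fun i => ‖fderiv ℝ (Φ i) a‖)
      (fun i _ => norm_nonneg _) (Finset.mem_univ i)
    linarith
  obtain ⟨c, hc, hcpos⟩ : ∃ c : ℝ, c < |jac Φ a| ∧ 0 < c :=
    ⟨|jac Φ a| / 2, by have := abs_pos.2 hΦa; linarith, by have := abs_pos.2 hΦa; linarith⟩
  set D : ℝ := (n + 1) * B * (C * L) ^ (k + 1) with hD
  have hDpos : 0 < D := by positivity
  set δ : ℝ := ε * c / D with hδ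
  have hδpos : 0 < δ := by positivity
  have hjac : Continuous (jac Φ) := (contDiff_jac (k := 0) (by simpa using hΦ)).continuous
  have hΦ' : ∀ i, Continuous (fderiv ℝ (Φ i)) := fun i => (hΦ i).continuous_fderiv one_ne_zero
  have ev1 : ∀ᶠ y in 𝓝 a, c < |jac Φ y| :=
    hjac.abs.continuousAt.eventually (lt_mem_nhds hc)
  have ev2 : ∀ᶠ y in 𝓝 a, ∀ i, ‖fderiv ℝ (Φ i) y‖ < B :=
    Filter.eventually_all.2 fun i =>
      (hΦ' i).norm.continuousAt.eventually (gt_mem_nhds (hB i))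
  have ev3 : ∀ᶠ p : Ec n × Ec n in 𝓝 a ×ˢ 𝓝 a, ∀ j, j ∉ J → p.1 ∈ K →
      (∀ i ∈ J', Ψ i p.2 = Ψ i p.1) →
      |jac (Function.update Φ j f) p.2| ≤ δ * ‖p.2 - p.1‖ ^ k := by
    rw [← nhds_prod_eq]
    refine Filter.eventually_all.2 fun j => ?_
    by_cases hj : j ∈ J
    · simp [hj]
    · simpa [hj] using H j hj δ hδpos
  obtain ⟨U, hU, hUp⟩ := Filter.eventually_prod_self_iff'.1 ev3
  have hθc : ContinuousAt θ (F a) := hθ.continuousAt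
  have evz : ∀ᶠ z in 𝓝 (F a), DifferentiableAt ℝ θ z ∧ ‖fderiv ℝ θ z‖ ≤ C ∧
      (∀ᶠ z' in 𝓝 z, ∀ i, Ψ i (θ z') = z' i) ∧ θ z ∈ U ∧ c < |jac Φ (θ z)| ∧
      ∀ i, ‖fderiv ℝ (Φ i) (θ z)‖ < B := by
    have h1 : ∀ᶠ z in 𝓝 (F a), ContDiffAt ℝ 1 θ z := hθ.eventually (by simp)
    have h2 : ∀ᶠ z in 𝓝 (F a), ‖fderiv ℝ θ z‖ < C :=
      ((hθ.fderiv_right (m := 0) (by norm_num)).continuousAt.norm).eventually (gt_mem_nhds hC)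
    have h3 := eventually_eventually_nhds.2 hright
    have htend : Tendsto θ (𝓝 (F a)) (𝓝 a) := by simpa [ContinuousAt, hθa] using hθc
    filter_upwards [h1, h2, h3, htend.eventually hU, htend.eventually ev1,
      htend.eventually ev2] with z a1 a2 a3 a4 a5 a6
    exact ⟨a1.differentiableAt one_ne_zero, a2.le, a3, a4, a5, a6⟩
  obtain ⟨R, hR, hball⟩ := Metric.eventually_nhds_iff_ball.1 evz
  have evx : ∀ᶠ y in 𝓝 a, y ∈ U ∧ y ∈ t ∧ F y ∈ ball (F a) R ∧ θ (F y) = y := by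
    filter_upwards [hU, ht, hFd.continuous.continuousAt.eventually (ball_mem_nhds (F a) hR),
      hleft] with y h1 h2 h3 h4
    exact ⟨h1, h2, h3, h4⟩
  rw [nhds_prod_eq]
  filter_upwards [evx.prod_mk evx]
  rintro ⟨x, y⟩ ⟨⟨hxU, hxt, hxb, hxθ⟩, ⟨-, hyt, hyb, hyθ⟩⟩ hxK hlev
  simp only at *
  set d : ℝ := ‖y - x‖ with hd
  set v : Fin n → ℝ := F y - F x with hv
  have hvd : ‖v‖ ≤ L * d := by
    have := hL₀.norm_sub_le hyt hxt
    exact this.trans (mul_le_mul_of_nonneg_right hL (norm_nonneg _))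
  have hz : ∀ s ∈ Icc (0 : ℝ) 1, F x + s • v ∈ ball (F a) R := fun s hs =>
    (convex_ball _ _).add_smul_sub_mem hxb hyb hs
  have hline : ∀ s : ℝ, HasDerivAt (fun s : ℝ => F x + s • v) v s := by
    intro s
    simpa using ((hasDerivAt_id s).smul_const v).const_add (F x)
  have hγ : ∀ s ∈ Icc (0 : ℝ) 1, HasDerivAt (fun s : ℝ => θ (F x + s • v))
      (fderiv ℝ θ (F x + s • v) v) s := fun s hs =>
    (hball _ (hz s hs)).1.hasFDerivAt.comp_hasDerivAt s (hline s)
  have hφ : ∀ s ∈ Icc (0 : ℝ) 1, HasDerivAt (fun s : ℝ => f (θ (F x + s • v)))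
      (fderiv ℝ f (θ (F x + s • v)) (fderiv ℝ θ (F x + s • v) v)) s := fun s hs =>
    ((hf.differentiable one_ne_zero) _).hasFDerivAt.comp_hasDerivAt s (hγ s hs)
  have hbound : ∀ s ∈ Icc (0 : ℝ) 1,
      ‖fderiv ℝ f (θ (F x + s • v)) (fderiv ℝ θ (F x + s • v) v)‖ ≤ ε * d ^ (k + 1) := by
    intro s hs
    obtain ⟨-, hCs, hinv, hUs, hcs, hBs⟩ := hball _ (hz s hs)
    set q := θ (F x + s • v) with hq
    set w := fderiv ℝ θ (F x + s • v) v with hw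
    have hwn : ‖w‖ ≤ C * (L * d) :=
      (ContinuousLinearMap.le_opNorm _ _).trans
        (mul_le_mul hCs hvd (norm_nonneg _) hCpos.le)
    have hqx : ‖q - x‖ ≤ C * (L * d) := by
      have h1 := Convex.norm_image_sub_le_of_norm_fderiv_le (𝕜 := ℝ) (f := θ) (C := C)
        (fun z hz => (hball z hz).1) (fun z hz => (hball z hz).2.1) (convex_ball (F a) R)
        hxb (hz s hs)
      rw [hxθ, ← hq] at h1
      refine h1.trans (mul_le_mul_of_nonneg_left ?_ hCpos.le)
      rw [add_sub_cancel_left, norm_smul, Real.norm_eq_abs, abs_of_nonneg hs.1]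
      exact (mul_le_of_le_one_left (norm_nonneg _) hs.2).trans hvd
    have hΨw : ∀ i, fderiv ℝ (Ψ i) q w = v i := by
      intro i
      have h1 : HasDerivAt (fun s : ℝ => Ψ i (θ (F x + s • v))) (fderiv ℝ (Ψ i) q w) s :=
        (((hΨ i).differentiable one_ne_zero) _).hasFDerivAt.comp_hasDerivAt s (hγ s hs)
      have h2 : HasDerivAt (fun s : ℝ => (F x + s • v) i) (v i) s :=
        (hasDerivAt_pi.1 (hline s)) i
      have h3 : (fun s : ℝ => Ψ i (θ (F x + s • v))) =ᶠ[𝓝 s] fun s => (F x + s • v) i := by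
        have := (hline s).continuousAt.eventually hinv
        filter_upwards [this] with r hr using hr i
      exact (h2.congr_of_eventuallyEq h3).unique h1 |>.symm
    have hvJ : ∀ i ∈ J', v i = 0 := fun i hi => by simp [hv, hF, hlev i hi]
    have hlevq : ∀ i ∈ J', Ψ i q = Ψ i x := fun i hi => by
      rw [hinv.self_of_nhds i]
      simp [hvJ i hi, hF]
    have hterm : ∀ i, |jac (Function.update Φ i f) q * fderiv ℝ (Φ i) q w| ≤
        δ * (C * (L * d)) ^ k * (B * (C * (L * d))) := by
      intro i
      by_cases hi : i ∈ J
      · rw [← hag i hi, hΨw i, hvJ i (hJ hi), mul_zero, abs_zero]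
        positivity
      · rw [abs_mul]
        refine mul_le_mul ?_ ?_ (abs_nonneg _) (by positivity)
        · refine (hUp x hxU q hUs i hi hxK hlevq).trans ?_
          gcongr
        · exact (ContinuousLinearMap.le_opNorm _ _).trans
            (mul_le_mul (hBs i).le hwn (norm_nonneg _) hBpos.le)
    have hsum : |jac Φ q * fderiv ℝ f q w| ≤
        n * (δ * (C * (L * d)) ^ k * (B * (C * (L * d)))) := by
      rw [jac_mul_fderiv]
      refine (Finset.abs_sum_le_sum_abs _ _).trans ((Finset.sum_le_sum fun i _ => hterm i).trans ?_)
      simp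
    have hfin : c * ‖fderiv ℝ f q w‖ ≤ c * (ε * d ^ (k + 1)) := by
      calc c * ‖fderiv ℝ f q w‖ ≤ |jac Φ q| * |fderiv ℝ f q w| :=
            mul_le_mul_of_nonneg_right hcs.le (norm_nonneg _)
        _ ≤ n * (δ * (C * (L * d)) ^ k * (B * (C * (L * d)))) := by rw [← abs_mul]; exact hsum
        _ ≤ (n + 1) * (δ * (C * (L * d)) ^ k * (B * (C * (L * d)))) := by
            gcongr; linarith
        _ = δ * D * d ^ (k + 1) := by rw [hD]; ring
        _ = c * (ε * d ^ (k + 1)) := by rw [hδ, div_mul_cancel₀ _ hDpos.ne']; ring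
    exact le_of_mul_le_mul_left hfin hcpos
  have hmv := norm_image_sub_le_of_norm_deriv_le_segment_01'
    (fun s hs => (hφ s hs).hasDerivWithinAt) (fun s hs => hbound s (Ico_subset_Icc_self hs))
  have e1 : F x + (1 : ℝ) • v = F y := by simp [hv]
  have e0 : F x + (0 : ℝ) • v = F x := by simp
  rw [e1, e0, hxθ, hyθ] at hmv
  exact hmv

/-- `K ⊆ A` is contained in a submanifold `{Ψ j = 0, j ∈ J' \ J}` transverse to the level sets
of `(Φ j)_{j ∈ J}`, and every `C^k` function vanishing on `A` vanishes to order `k` at the points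
of `K` along the level sets of `(Ψ j)_{j ∈ J'}`. -/
def IsMorsePiece {n : ℕ} (k : ℕ) (Φ : Fin n → Ec n → ℝ) (J : Finset (Fin n))
    (A K : Set (Ec n)) : Prop :=
  IsCompact K ∧ K ⊆ A ∧ ∃ (Ψ : Fin n → Ec n → ℝ) (J' : Finset (Fin n)), J ⊆ J' ∧
    (∀ j ∈ J, Ψ j = Φ j) ∧ (∀ j ∈ J', j ∉ J → ∀ x ∈ K, Ψ j x = 0) ∧
    (∀ x ∈ K, jac Ψ x ≠ 0) ∧ (∀ i, ContDiff ℝ 1 (Ψ i)) ∧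
    ∀ f : Ec n → ℝ, ContDiff ℝ k f → (∀ x ∈ A, f x = 0) → ∀ a ∈ K, ∀ ε > (0 : ℝ),
      ∀ᶠ p : Ec n × Ec n in 𝓝 (a, a), p.1 ∈ K → (∀ i ∈ J', Ψ i p.2 = Ψ i p.1) →
        |f p.2| ≤ ε * ‖p.2 - p.1‖ ^ k

lemma isMorsePiece_zero {n : ℕ} {Φ : Fin n → Ec n → ℝ} (hΦ : ∀ i, ContDiff ℝ 1 (Φ i))
    (J : Finset (Fin n)) {A : Set (Ec n)} (hA : IsCompact A) (hj : ∀ x ∈ A, jac Φ x ≠ 0) :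
    IsMorsePiece 0 Φ J A A := by
  refine ⟨hA, subset_rfl, Φ, J, subset_rfl, fun _ _ => rfl, fun j hj hj' => absurd hj hj', hj, hΦ,
    fun f hf hfA a ha ε hε => ?_⟩
  have h0 : ContinuousAt (fun p : Ec n × Ec n => |f p.2|) (a, a) :=
    (hf.continuous.comp continuous_snd).abs.continuousAt
  have h1 : ∀ᶠ p : Ec n × Ec n in 𝓝 (a, a), |f p.2| < ε :=
    h0.eventually (gt_mem_nhds (by simpa [hfA a ha] using hε))
  filter_upwards [h1] with p hp _ _
  simpa using hp.le

lemma IsMorsePiece.of_update {n k : ℕ} {Φ : Fin n → Ec n → ℝ} {J : Finset (Fin n)}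
    {A A₀ K : Set (Ec n)} {g : Ec n → ℝ} {j : Fin n} (hj : j ∉ J) (hg : ∀ x ∈ A, g x = 0)
    (hA : A₀ ⊆ A) (h : IsMorsePiece k (Function.update Φ j g) (insert j J) A₀ K) :
    IsMorsePiece k Φ J A K := by
  obtain ⟨hK, hKA, Ψ, J', hJ, hag, h0, hne, hC, hf⟩ := h
  refine ⟨hK, hKA.trans hA, Ψ, J', (Finset.subset_insert _ _).trans hJ, fun i hi => ?_,
    fun i hi hiJ x hx => ?_, hne, hC, fun f hfk hfA => hf f hfk fun x hx => hfA x (hA hx)⟩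
  · rw [hag i (Finset.mem_insert_of_mem hi), Function.update_of_ne]
    rintro rfl
    exact hj hi
  · by_cases hij : i = j
    · subst hij
      rw [hag i (Finset.mem_insert_self _ _), Function.update_self]
      exact hg x (hA (hKA hx))
    · exact h0 i hi (by simp [hij, hiJ]) x hx

lemma IsMorsePiece.eventually_abs_sub_le {n k : ℕ} {Φ : Fin n → Ec n → ℝ} {J : Finset (Fin n)}
    {A K : Set (Ec n)} (hΦ : ∀ i, ContDiff ℝ (k + 1 : ℕ) (Φ i)) (hne : ∀ x ∈ A, jac Φ x ≠ 0)
    (h : IsMorsePiece k Φ J A K) :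
    ∃ (Ψ : Fin n → Ec n → ℝ) (J' : Finset (Fin n)), J ⊆ J' ∧
      (∀ j ∈ J, Ψ j = Φ j) ∧ (∀ j ∈ J', j ∉ J → ∀ x ∈ K, Ψ j x = 0) ∧
      (∀ x ∈ K, jac Ψ x ≠ 0) ∧ (∀ i, ContDiff ℝ 1 (Ψ i)) ∧
      ∀ f : Ec n → ℝ, ContDiff ℝ (k + 1 : ℕ) f →
        (∀ x ∈ A, ∀ j, j ∉ J → jac (Function.update Φ j f) x = 0) → ∀ a ∈ K, ∀ ε > (0 : ℝ),
        ∀ᶠ p : Ec n × Ec n in 𝓝 (a, a), p.1 ∈ K → (∀ i ∈ J', Ψ i p.2 = Ψ i p.1) →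
          |f p.2 - f p.1| ≤ ε * ‖p.2 - p.1‖ ^ (k + 1) := by
  obtain ⟨hK, hKA, Ψ, J', hJ, hag, h0, hneΨ, hC, hf⟩ := h
  have h1 : (1 : WithTop ℕ∞) ≤ (k + 1 : ℕ) := by norm_cast; omega
  refine ⟨Ψ, J', hJ, hag, h0, hneΨ, hC, fun f hfk hfA a ha => ?_⟩
  refine _root_.eventually_abs_sub_le (fun i => (hΦ i).of_le h1) hC (hne a (hKA ha)) (hneΨ a ha)
    hJ hag (hfk.of_le h1) fun j hj ε hε => ?_
  exact hf _ (contDiff_jac (contDiff_update_family hΦ hfk j)) (fun x hx => hfA x hx j hj) a ha ε hε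

/-- A generalized Morse vanishing lemma with parameters. -/
theorem exists_countable_isMorsePiece {n : ℕ} (k : ℕ) :
    ∀ (q : ℕ) (Φ : Fin n → Ec n → ℝ) (J : Finset (Fin n)) (A : Set (Ec n)),
      Jᶜ.card = q → (∀ i, ContDiff ℝ k (Φ i)) → (∀ i, ContDiff ℝ 1 (Φ i)) →
      IsCompact A → (∀ x ∈ A, jac Φ x ≠ 0) →
      ∃ S : Set (Set (Ec n)), S.Countable ∧ (∀ K ∈ S, IsMorsePiece k Φ J A K) ∧ A ⊆ ⋃₀ S := by
  induction k with
  | zero =>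
    intro q Φ J A _ _ hΦ hA hne
    exact ⟨{A}, countable_singleton A, by simpa using isMorsePiece_zero hΦ J hA hne, by simp⟩
  | succ k ihk =>
    intro q
    induction q using Nat.strong_induction_on with
    | _ q ihq =>
    intro Φ J A hq hΦ hΦ1 hA hne
    have h1 : (1 : WithTop ℕ∞) ≤ (k + 1 : ℕ) := by norm_cast; omega
    have hk1 : (k : WithTop ℕ∞) ≤ (k + 1 : ℕ) := by norm_cast; omega
    let ι := {p : (Ec n → ℝ) × Fin n //
      ContDiff ℝ (k + 1 : ℕ) p.1 ∧ (∀ x ∈ A, p.1 x = 0) ∧ p.2 ∉ J}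
    have hupd : ∀ p : ι, ∀ i, ContDiff ℝ (k + 1 : ℕ) (Function.update Φ p.1.2 p.1.1 i) :=
      fun p => contDiff_update_family hΦ p.2.1 _
    have hcont : ∀ p : ι, Continuous (jac (Function.update Φ p.1.2 p.1.1)) :=
      fun p => (contDiff_jac (hupd p)).continuous
    obtain ⟨T, hT, hTU⟩ := TopologicalSpace.isOpen_iUnion_countable
      (fun p : ι => {x | jac (Function.update Φ p.1.2 p.1.1) x ≠ 0})
      fun p => isOpen_ne_fun (hcont p) continuous_const
    have hpiece : ∀ (p : ι) (N : ℕ), ∃ S : Set (Set (Ec n)), S.Countable ∧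
        (∀ K ∈ S, IsMorsePiece (k + 1) Φ J A K) ∧
        A ∩ {x | (1 : ℝ) / (N + 1) ≤ |jac (Function.update Φ p.1.2 p.1.1) x|} ⊆ ⋃₀ S := by
      intro p N
      have hlt : (insert p.1.2 J)ᶜ.card < q := by
        rw [← hq]
        refine Finset.card_lt_card (Finset.compl_ssubset_compl.2 (Finset.ssubset_insert p.2.2.2))
      obtain ⟨S, hS, hSp, hSA⟩ := ihq _ hlt (Function.update Φ p.1.2 p.1.1) (insert p.1.2 J)
        (A ∩ {x | (1 : ℝ) / (N + 1) ≤ |jac (Function.update Φ p.1.2 p.1.1) x|}) rfl (hupd p)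
        (fun i => (hupd p i).of_le h1)
        (hA.inter_right (isClosed_le continuous_const (hcont p).abs))
        (fun x hx => by
          have : (0 : ℝ) < 1 / (N + 1) := by positivity
          exact abs_pos.1 (this.trans_le hx.2))
      exact ⟨S, hS, fun K hK => (hSp K hK).of_update p.2.2.2 p.2.2.1 inter_subset_left, hSA⟩
    choose S hS hSp hSA using hpiece
    set A' : Set (Ec n) := A \ ⋃ p : ι, {x | jac (Function.update Φ p.1.2 p.1.1) x ≠ 0} with hA'
    obtain ⟨S', hS', hSp', hSA'⟩ := ihk _ Φ J A' rfl (fun i => (hΦ i).of_le hk1) hΦ1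
      (hA.diff (isOpen_iUnion fun p => isOpen_ne_fun (hcont p) continuous_const))
      (fun x hx => hne x hx.1)
    refine ⟨S' ∪ ⋃ p ∈ T, ⋃ N, S p N, hS'.union (hT.biUnion fun p _ => countable_iUnion (hS p)),
      ?_, ?_⟩
    · rintro K (hK | hK)
      · have hKp := hSp' K hK
        obtain ⟨Ψ, J', hJ, hag, h0, hneΨ, hC, hf⟩ :=
          hKp.eventually_abs_sub_le hΦ (fun x hx => hne x hx.1)
        refine ⟨hKp.1, hKp.2.1.trans sdiff_subset, Ψ, J', hJ, hag, h0, hneΨ, hC,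
          fun f hfk hfA a ha ε hε => ?_⟩
        have hvan : ∀ x ∈ A', ∀ j, j ∉ J → jac (Function.update Φ j f) x = 0 := by
          intro x hx j hj
          by_contra hcon
          exact hx.2 (mem_iUnion.2 ⟨⟨(f, j), hfk, hfA, hj⟩, hcon⟩)
        filter_upwards [hf f hfk hvan a ha ε hε] with p hp hpK hlev
        simpa [hfA p.1 (hKp.2.1 hpK).1] using hp hpK hlev
      · simp only [mem_iUnion] at hK
        obtain ⟨p, -, N, hK⟩ := hK
        exact hSp p N K hK
    · intro x hx
      by_cases hxU : x ∈ ⋃ p : ι, {x | jac (Function.update Φ p.1.2 p.1.1) x ≠ 0}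
      · rw [← hTU] at hxU
        simp only [mem_iUnion] at hxU
        obtain ⟨p, hpT, hxp⟩ := hxU
        obtain ⟨N, hN⟩ := exists_nat_one_div_lt (abs_pos.2 hxp)
        obtain ⟨K, hK, hxK⟩ := hSA p N ⟨hx, hN.le⟩
        refine ⟨K, Or.inr ?_, hxK⟩
        simp only [mem_iUnion]
        exact ⟨p, hpT, N, hK⟩
      · obtain ⟨K, hK, hxK⟩ := hSA' ⟨hx, hxU⟩
        exact ⟨K, Or.inl hK, hxK⟩

lemma IsCompact.exists_dist_lt_imp {X : Type*} [PseudoMetricSpace X] {K : Set X}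
    (hK : IsCompact K) {P : X × X → Prop} (h : ∀ a ∈ K, ∀ᶠ p in 𝓝 (a, a), P p) :
    ∃ δ > (0 : ℝ), ∀ x ∈ K, ∀ y, dist x y < δ → P (x, y) := by
  have hD : IsCompact ((fun x : X => (x, x)) '' K) :=
    hK.image (continuous_id.prodMk continuous_id)
  obtain ⟨δ, hδ, hsub⟩ := hD.exists_thickening_subset_open (isOpen_interior (s := {p | P p})) (by
    rintro _ ⟨a, ha, rfl⟩
    exact mem_interior_iff_mem_nhds.2 (h a ha))
  refine ⟨δ, hδ, fun x hx y hxy => interior_subset (hsub ?_)⟩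
  refine Metric.mem_thickening_iff.2 ⟨(x, x), ⟨x, hx, rfl⟩, ?_⟩
  simpa [Prod.dist_eq, dist_comm, hδ] using hxy

/-- A compact set whose one-dimensional slices in direction `l₀` have diameter at most `b` has
volume at most `diam ^ m * b`. -/
lemma volume_le_of_slice_edist_le {m : ℕ} {Q : Set (Fin (m + 1) → ℝ)} (hQ : IsCompact Q)
    (l₀ : Fin (m + 1)) {a b : ENNReal} (ha : ∀ z ∈ Q, ∀ w ∈ Q, edist z w ≤ a)
    (hb : ∀ z ∈ Q, ∀ w ∈ Q, (∀ l, l ≠ l₀ → z l = w l) → edist (z l₀) (w l₀) ≤ b) :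
    volume Q ≤ a ^ m * b := by
  let e := MeasurableEquiv.piFinSuccAbove (fun _ : Fin (m + 1) => ℝ) l₀
  have he : MeasurePreserving e.symm volume volume :=
    (volume_preserving_piFinSuccAbove (fun _ : Fin (m + 1) => ℝ) l₀).symm e
  let π : (Fin (m + 1) → ℝ) → Fin m → ℝ := fun z i => z (l₀.succAbove i)
  have hπ : Continuous π := continuous_pi fun i => continuous_apply _
  have hπe : ∀ (s : ℝ) (v : Fin m → ℝ), π (e.symm (s, v)) = v := by
    intro s v
    ext i
    exact Fin.insertNth_apply_succAbove (α := fun _ => ℝ) l₀ s v i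
  have hse : ∀ (s : ℝ) (v : Fin m → ℝ), e.symm (s, v) l₀ = s := by
    intro s v
    exact Fin.insertNth_apply_same (α := fun _ => ℝ) l₀ s v
  have hdiam : volume (π '' Q) ≤ a ^ m := by
    refine (Real.volume_pi_le_diam_pow _).trans ?_
    rw [Fintype.card_fin]
    gcongr
    refine Metric.ediam_le ?_
    rintro _ ⟨z, hz, rfl⟩ _ ⟨w, hw, rfl⟩
    refine le_trans ?_ (ha z hz w hw)
    exact edist_pi_le_iff.2 fun i => edist_le_pi_edist z w _
  have hmeas : MeasurableSet (e.symm ⁻¹' Q) := e.symm.measurable hQ.measurableSet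
  rw [← he.measure_preimage hQ.measurableSet.nullMeasurableSet, Measure.volume_eq_prod,
    Measure.prod_apply_symm hmeas]
  calc ∫⁻ v : Fin m → ℝ, volume ((fun s : ℝ => (s, v)) ⁻¹' (e.symm ⁻¹' Q))
      ≤ ∫⁻ v : Fin m → ℝ, (π '' Q).indicator (fun _ => b) v := by
        refine lintegral_mono fun v => ?_
        by_cases hv : v ∈ π '' Q
        · rw [indicator_of_mem hv]
          refine (Real.volume_le_diam _).trans (Metric.ediam_le ?_)
          intro s hs r hr
          have := hb _ hs _ hr fun l hl => by
            obtain ⟨i, rfl⟩ := Fin.exists_succAbove_eq hl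
            exact (congrFun (hπe s v) i).trans (congrFun (hπe r v) i).symm
          simpa only [hse] using this
        · rw [indicator_of_notMem hv]
          have : (fun s : ℝ => (s, v)) ⁻¹' (e.symm ⁻¹' Q) = ∅ := by
            ext s
            simp only [mem_preimage, mem_empty_iff_false, iff_false]
            exact fun hs => hv ⟨_, hs, hπe s v⟩
          simp [this]
    _ = b * volume (π '' Q) := by
        rw [lintegral_indicator (hQ.image hπ).measurableSet]
        simp
    _ ≤ a ^ m * b := by rw [mul_comm]; gcongr

lemma volume_image_le {n m k : ℕ} {f : Ec n → Ec (m + 1)} (hf : Continuous f) {K : Set (Ec n)}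
    (hK : IsCompact K) {Λ : NNReal} (hΛ : LipschitzOnWith Λ f K) (l₀ : Fin (m + 1)) {ε δ : ℝ}
    (h : ∀ x ∈ K, ∀ y ∈ K, dist x y < δ → (∀ l, l ≠ l₀ → f x l = f y l) →
      |f y l₀ - f x l₀| ≤ ε * ‖y - x‖ ^ k) {t : Set (Ec n)}
    (ht : ediam t < ENNReal.ofReal δ) :
    volume (f '' (t ∩ K)) ≤ Λ ^ m * ENNReal.ofReal ε * ediam t ^ (k + m) := by
  let Q : Set (Fin (m + 1) → ℝ) := (fun x => (f x).ofLp) '' (closure t ∩ K)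
  have hQ : IsCompact Q :=
    (hK.inter_left isClosed_closure).image (by fun_prop)
  have hvol : volume (f '' (t ∩ K)) ≤ volume Q := by
    have hmp := EuclideanSpace.volume_preserving_symm_measurableEquiv_toLp (Fin (m + 1))
    rw [← hmp.measure_preimage hQ.measurableSet.nullMeasurableSet]
    refine measure_mono ?_
    rintro _ ⟨x, hx, rfl⟩
    exact ⟨x, ⟨subset_closure hx.1, hx.2⟩, rfl⟩
  have hcl : ∀ x ∈ closure t, ∀ y ∈ closure t, edist x y ≤ ediam t := fun x hx y hy => by
    rw [← Metric.ediam_closure]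
    exact Metric.edist_le_ediam_of_mem hx hy
  refine hvol.trans ((volume_le_of_slice_edist_le hQ l₀ (a := Λ * ediam t)
    (b := ENNReal.ofReal ε * ediam t ^ k) ?_ ?_).trans_eq ?_)
  · rintro _ ⟨x, hx, rfl⟩ _ ⟨y, hy, rfl⟩
    have h1 : edist (f x) (f y) ≤ Λ * ediam t :=
      (hΛ hx.2 hy.2).trans (by gcongr; exact hcl x hx.1 y hy.1)
    refine le_trans (edist_pi_le_iff.2 fun l => ?_) h1
    rw [edist_dist, edist_dist]
    refine ENNReal.ofReal_le_ofReal ?_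
    rw [dist_eq_norm, dist_eq_norm]
    exact PiLp.norm_apply_le (f x - f y) l
  · rintro _ ⟨x, hx, rfl⟩ _ ⟨y, hy, rfl⟩ hl
    have hxy := hcl x hx.1 y hy.1
    have hd : dist x y < δ := by
      have : edist x y < ENNReal.ofReal δ := hxy.trans_lt ht
      rw [edist_dist] at this
      exact (ENNReal.ofReal_lt_ofReal_iff_of_nonneg dist_nonneg).1 this
    have h1 := h x hx.2 y hy.2 hd hl
    rw [edist_comm, edist_dist, Real.dist_eq]
    refine (ENNReal.ofReal_le_ofReal h1).trans ?_
    rw [ENNReal.ofReal_mul' (by positivity), ENNReal.ofReal_pow (norm_nonneg _), ← dist_eq_norm,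
      ← edist_dist, edist_comm]
    gcongr
  · ring

lemma volume_image_eq_zero {n m k : ℕ} {f : Ec n → Ec (m + 1)} (hf : Continuous f)
    {K : Set (Ec n)} (hK : IsCompact K) {Λ : NNReal} (hΛ : LipschitzOnWith Λ f K)
    (l₀ : Fin (m + 1))
    (h : ∀ ε > (0 : ℝ), ∃ δ > (0 : ℝ), ∀ x ∈ K, ∀ y ∈ K, dist x y < δ →
      (∀ l, l ≠ l₀ → f x l = f y l) → |f y l₀ - f x l₀| ≤ ε * ‖y - x‖ ^ k)
    {T : Set (Ec n)} (hT : μH[((k + m : ℕ) : ℝ)] T < ⊤) :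
    volume (f '' (T ∩ K)) = 0 := by
  set M := μH[((k + m : ℕ) : ℝ)] T with hM
  have key : ∀ ε > (0 : ℝ), volume (f '' (T ∩ K)) ≤ Λ ^ m * (M + 1) * ENNReal.ofReal ε := by
    intro ε hε
    obtain ⟨δ, hδ, hδp⟩ := h ε hε
    have hr : 0 < ENNReal.ofReal (δ / 2) := ENNReal.ofReal_pos.2 (by positivity)
    have hlt : M < M + 1 := ENNReal.lt_add_right hT.ne one_ne_zero
    have h1 := hM.symm.le
    rw [Measure.hausdorffMeasure_apply] at h1
    have h2 := (iSup₂_le_iff.1 h1 _ hr).trans_lt hlt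
    simp only [iInf_lt_iff] at h2
    obtain ⟨t, hTt, htd, hsum⟩ := h2
    have hterm : ∀ j, volume (f '' (t j ∩ K)) ≤ Λ ^ m * ENNReal.ofReal ε *
        ⨆ _ : (t j).Nonempty, ediam (t j) ^ ((k + m : ℕ) : ℝ) := by
      intro j
      rcases (t j).eq_empty_or_nonempty with h0 | h0
      · simp [h0]
      · rw [ciSup_pos h0, ENNReal.rpow_natCast]
        refine volume_image_le hf hK hΛ l₀ hδp ((htd j).trans_lt ?_)
        exact (ENNReal.ofReal_lt_ofReal_iff hδ).2 (by linarith)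
    calc volume (f '' (T ∩ K)) ≤ volume (⋃ j, f '' (t j ∩ K)) := by
          refine measure_mono ?_
          rintro _ ⟨x, ⟨hxT, hxK⟩, rfl⟩
          obtain ⟨j, hj⟩ := mem_iUnion.1 (hTt hxT)
          exact mem_iUnion.2 ⟨j, x, ⟨hj, hxK⟩, rfl⟩
      _ ≤ ∑' j, volume (f '' (t j ∩ K)) := measure_iUnion_le _
      _ ≤ ∑' j, Λ ^ m * ENNReal.ofReal ε *
            ⨆ _ : (t j).Nonempty, ediam (t j) ^ ((k + m : ℕ) : ℝ) := ENNReal.tsum_le_tsum hterm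
      _ = Λ ^ m * ENNReal.ofReal ε *
            ∑' j, ⨆ _ : (t j).Nonempty, ediam (t j) ^ ((k + m : ℕ) : ℝ) := ENNReal.tsum_mul_left
      _ ≤ Λ ^ m * ENNReal.ofReal ε * (M + 1) := by gcongr
      _ = Λ ^ m * (M + 1) * ENNReal.ofReal ε := by ring
  have hfin : (Λ : ENNReal) ^ m * (M + 1) ≠ ⊤ :=
    ENNReal.mul_ne_top (by finiteness) (ENNReal.add_ne_top.2 ⟨hT.ne, ENNReal.one_ne_top⟩)
  have hlim : Tendsto (fun ε : ℝ => (Λ : ENNReal) ^ m * (M + 1) * ENNReal.ofReal ε)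
      (𝓝[>] 0) (𝓝 0) := by
    have h1 : Tendsto (fun ε : ℝ => ENNReal.ofReal ε) (𝓝[>] 0) (𝓝 0) := by
      have := (ENNReal.continuous_ofReal.tendsto 0).mono_left (nhdsWithin_le_nhds (s := Ioi 0))
      simpa using this
    simpa using ENNReal.Tendsto.const_mul h1 (Or.inr hfin)
  refine le_antisymm (ge_of_tendsto hlim ?_) zero_le
  filter_upwards [self_mem_nhdsWithin] with ε hε using key ε hε

/-- The family of functions whose `i`-th member is the component of `f` or the coordinate function
selected by `τ i`. -/
def mixedCoord {n m : ℕ} (f : Ec n → Ec m) (τ : Fin n → Fin m ⊕ Fin n) (i : Fin n) :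
    Ec n → ℝ :=
  Sum.elim (fun l x => f x l) (fun j x => x j) (τ i)

lemma contDiff_mixedCoord {n m : ℕ} {k : WithTop ℕ∞} {f : Ec n → Ec m} (hf : ContDiff ℝ k f)
    (τ : Fin n → Fin m ⊕ Fin n) (i : Fin n) : ContDiff ℝ k (mixedCoord f τ i) := by
  unfold mixedCoord
  cases τ i with
  | inl l => exact contDiff_euclidean.1 hf l
  | inr j => exact contDiff_euclidean.1 contDiff_id j

lemma update_mixedCoord {n m : ℕ} (f : Ec n → Ec m) (τ : Fin n → Fin m ⊕ Fin n) (j : Fin n)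
    (l : Fin m) : Function.update (mixedCoord f τ) j (fun x => f x l) =
      mixedCoord f (Function.update τ j (Sum.inl l)) := by
  ext i x
  by_cases h : i = j
  · subst h
    simp [mixedCoord]
  · simp [mixedCoord, h]

lemma jac_mixedCoord_inr {n m : ℕ} (f : Ec n → Ec m) (x : Ec n) :
    jac (mixedCoord f Sum.inr) x = 1 := by
  have h : (Matrix.of fun i j => fderiv ℝ (mixedCoord f (Sum.inr : Fin n → Fin m ⊕ Fin n) i) x
      (EuclideanSpace.single j 1)) = 1 := by
    ext i j
    have : fderiv ℝ (mixedCoord f (Sum.inr : Fin n → Fin m ⊕ Fin n) i) x =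
        EuclideanSpace.proj (𝕜 := ℝ) i :=
      (EuclideanSpace.proj (𝕜 := ℝ) i : Ec n →L[ℝ] ℝ).hasFDerivAt.fderiv
    simp [this, Matrix.one_apply, PiLp.single_apply]
  rw [jac, h, Matrix.det_one]

/-- The set of indices at which `τ` selects a component of `f`. -/
def leftIndices {n m : ℕ} (τ : Fin n → Fin m ⊕ Fin n) : Finset (Fin n) :=
  Finset.univ.filter fun i => (τ i).isLeft = true

lemma exists_mixedCoord {n m : ℕ} (f : Ec n → Ec m) (x : Ec n) :
    ∃ τ : Fin n → Fin m ⊕ Fin n, jac (mixedCoord f τ) x ≠ 0 ∧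
      ∀ l, ∀ j, j ∉ leftIndices τ →
        jac (Function.update (mixedCoord f τ) j fun y => f y l) x = 0 := by
  classical
  obtain ⟨τ, hτ, hmax⟩ := Finset.exists_max_image
    (Finset.univ.filter fun τ : Fin n → Fin m ⊕ Fin n => jac (mixedCoord f τ) x ≠ 0)
    (fun τ => (leftIndices τ).card) ⟨Sum.inr, by simp [jac_mixedCoord_inr]⟩
  refine ⟨τ, by simpa using hτ, fun l j hj => ?_⟩
  by_contra hne
  rw [update_mixedCoord] at hne
  have hle := hmax (Function.update τ j (Sum.inl l)) (by simpa using hne)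
  refine absurd (Finset.card_lt_card (Finset.ssubset_iff.2 ⟨j, hj, fun i hi => ?_⟩)) hle.not_gt
  by_cases hij : i = j
  · subst hij
    simp [leftIndices]
  · have := Finset.mem_of_mem_insert_of_ne hi hij
    simpa [leftIndices, hij] using this

lemma exists_forall_ne_inl {n m : ℕ} {f : Ec n → Ec m} (hf : ContDiff ℝ 1 f) {x : Ec n}
    (hx : derivRank f x < m) {τ : Fin n → Fin m ⊕ Fin n} (hτ : jac (mixedCoord f τ) x ≠ 0) :
    ∃ l, ∀ i, τ i ≠ Sum.inl l := by
  by_contra! hcon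
  have hfl : ∀ l v, fderiv ℝ (fun y => f y l) x v = fderiv ℝ f x v l := by
    intro l v
    have h1 : HasFDerivAt (fun y => f y l)
        ((EuclideanSpace.proj (𝕜 := ℝ) l : Ec m →L[ℝ] ℝ).comp (fderiv ℝ f x)) x :=
      (EuclideanSpace.proj (𝕜 := ℝ) l : Ec m →L[ℝ] ℝ).hasFDerivAt.comp x
        (hf.differentiable one_ne_zero x).hasFDerivAt
    rw [h1.fderiv]
    rfl
  have hsurj : LinearMap.range ((fderiv ℝ f x : Ec n →L[ℝ] Ec m) : Ec n →ₗ[ℝ] Ec m) = ⊤ := by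
    refine LinearMap.range_eq_top.2 fun w => ?_
    obtain ⟨v, hv⟩ := surjective_of_jac_ne_zero hτ fun i => Sum.elim (fun l => w l) 0 (τ i)
    refine ⟨v, ?_⟩
    ext l
    obtain ⟨i, hi⟩ := hcon l
    have := hv i
    simp only [mixedCoord, hi, Sum.elim_inl, hfl] at this
    exact this
  rw [derivRank, hsurj, finrank_top, finrank_euclideanSpace_fin] at hx
  exact lt_irrefl _ hx

/-- The points of the closed ball of radius `N` at which the `mixedCoord f τ` are quantitatively
independent and the differential of `f` is spanned by the components of `f` selected by `τ`. -/
def criticalPiece {n m : ℕ} (f : Ec n → Ec m) (τ : Fin n → Fin m ⊕ Fin n) (N : ℕ) :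
    Set (Ec n) :=
  closedBall 0 N ∩ ({x | (1 : ℝ) / (N + 1) ≤ |jac (mixedCoord f τ) x|} ∩
    {x | ∀ l, ∀ j, j ∉ leftIndices τ →
      jac (Function.update (mixedCoord f τ) j fun y => f y l) x = 0})

lemma isCompact_criticalPiece {n m : ℕ} {f : Ec n → Ec m} (hf : ContDiff ℝ 1 f)
    (τ : Fin n → Fin m ⊕ Fin n) (N : ℕ) : IsCompact (criticalPiece f τ N) := by
  have hj : ∀ τ : Fin n → Fin m ⊕ Fin n, Continuous (jac (mixedCoord f τ)) := fun τ =>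
    (contDiff_jac (k := 0) (by simpa using contDiff_mixedCoord hf τ)).continuous
  refine (isCompact_closedBall _ _).inter_right
    ((isClosed_le continuous_const (hj τ).abs).inter ?_)
  simp only [ofPred_forall, update_mixedCoord]
  exact isClosed_iInter fun l => isClosed_iInter fun j => isClosed_iInter fun _ =>
    isClosed_eq (hj _) continuous_const

lemma exists_mem_criticalPiece {n m : ℕ} {f : Ec n → Ec m} (hf : ContDiff ℝ 1 f) {x : Ec n}
    (hx : derivRank f x < m) :
    ∃ τ : Fin n → Fin m ⊕ Fin n, (∃ l, ∀ i, τ i ≠ Sum.inl l) ∧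
      ∃ N, x ∈ criticalPiece f τ N := by
  obtain ⟨τ, hτ, hvan⟩ := exists_mixedCoord f x
  refine ⟨τ, exists_forall_ne_inl hf hx hτ, ?_⟩
  obtain ⟨N₁, hN₁⟩ := exists_nat_one_div_lt (abs_pos.2 hτ)
  obtain ⟨N₂, hN₂⟩ := exists_nat_ge ‖x‖
  refine ⟨max N₁ N₂, ?_, ?_, hvan⟩
  · rw [mem_closedBall_zero_iff]
    exact hN₂.trans (by exact_mod_cast le_max_right _ _)
  · refine le_trans ?_ hN₁.le
    gcongr
    exact le_max_left _ _

lemma IsMorsePiece.exists_dist_lt_imp {n m k : ℕ} {f : Ec n → Ec m}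
    (hf : ContDiff ℝ (k + 1 : ℕ) f) {τ : Fin n → Fin m ⊕ Fin n} {N : ℕ} {l₀ : Fin m}
    (hl₀ : ∀ i, τ i ≠ Sum.inl l₀) {K : Set (Ec n)}
    (hK : IsMorsePiece k (mixedCoord f τ) (leftIndices τ) (criticalPiece f τ N) K)
    {ε : ℝ} (hε : 0 < ε) :
    ∃ δ > (0 : ℝ), ∀ x ∈ K, ∀ y ∈ K, dist x y < δ → (∀ l, l ≠ l₀ → f x l = f y l) →
      |f y l₀ - f x l₀| ≤ ε * ‖y - x‖ ^ (k + 1) := by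
  have hne : ∀ x ∈ criticalPiece f τ N, jac (mixedCoord f τ) x ≠ 0 := fun x hx =>
    abs_pos.1 (lt_of_lt_of_le (by positivity) hx.2.1)
  obtain ⟨Ψ, J', -, hag, h0, -, -, hflat⟩ :=
    hK.eventually_abs_sub_le (contDiff_mixedCoord hf τ) hne
  obtain ⟨δ, hδ, hp⟩ := hK.1.exists_dist_lt_imp fun a ha =>
    hflat (fun x => f x l₀) (contDiff_euclidean.1 hf l₀) (fun x hx j hj => hx.2.2 l₀ j hj) a ha ε hε
  refine ⟨δ, hδ, fun x hx y hy hxy hl => hp x hx y hxy hx fun i hi => ?_⟩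
  by_cases hiJ : i ∈ leftIndices τ
  · rw [hag i hiJ]
    obtain ⟨l, hil⟩ := Sum.isLeft_iff.1 (Finset.mem_filter.1 hiJ).2
    have hne : l ≠ l₀ := fun h => hl₀ i (h ▸ hil)
    simpa [mixedCoord, hil] using (hl l hne).symm
  · rw [h0 i hi hiJ x hx, h0 i hi hiJ y hy]

/-- Norton, part ii: if `f ∈ C^k(ℝⁿ;ℝᵐ)` and `E` is a subset of the
critical set `C_f = {x : rank Df(x) < m}` which is `(k+m-1)`-sigmafinite (a countable
union of sets of finite `H^{k+m-1}`-measure), then `Lᵐ(f(E)) = 0`. -/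
theorem norton_part_ii {n m k : ℕ} (hk : 1 ≤ k)
    (f : Ec n → Ec m) (hf : ContDiff ℝ k f)
    (E : Set (Ec n)) (hE : E ⊆ {x | derivRank f x < m})
    (hsigma : ∃ T : ℕ → Set (Ec n), E = ⋃ j, T j ∧
      ∀ j, μH[(k : ℝ) + m - 1] (T j) < ⊤) :
    volume (f '' E) = 0 := by
  obtain ⟨k, rfl⟩ : ∃ k', k = k' + 1 := ⟨k - 1, by omega⟩
  have hf1 : ContDiff ℝ 1 f := hf.of_le (by norm_cast)
  obtain ⟨T, rfl, hT⟩ := hsigma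
  cases m with
  | zero =>
    have : ⋃ j, T j = ∅ := eq_empty_of_forall_notMem fun x hx => absurd (hE hx) (Nat.not_lt_zero _)
    simp [this]
  | succ m =>
    have hS : ∀ (τ : Fin n → Fin (m + 1) ⊕ Fin n) (N : ℕ), ∃ S : Set (Set (Ec n)), S.Countable ∧
        (∀ K ∈ S, IsMorsePiece k (mixedCoord f τ) (leftIndices τ) (criticalPiece f τ N) K) ∧
        criticalPiece f τ N ⊆ ⋃₀ S := fun τ N =>
      exists_countable_isMorsePiece k _ _ _ _ rfl
        (contDiff_mixedCoord (hf.of_le (by norm_cast; omega)) τ) (contDiff_mixedCoord hf1 τ)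
        (isCompact_criticalPiece hf1 τ N)
        fun x hx => abs_pos.1 (lt_of_lt_of_le (by positivity) hx.2.1)
    choose S hSc hSp hSA using hS
    have hsub : f '' (⋃ j, T j) ⊆ ⋃ (j : ℕ) (τ : Fin n → Fin (m + 1) ⊕ Fin n)
        (_ : ∃ l, ∀ i, τ i ≠ Sum.inl l) (N : ℕ), ⋃ K ∈ S τ N, f '' (T j ∩ K) := by
      rintro _ ⟨x, hx, rfl⟩
      obtain ⟨τ, hτ, N, hxN⟩ := exists_mem_criticalPiece hf1 (hE hx)
      obtain ⟨K, hK, hxK⟩ := hSA τ N hxN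
      obtain ⟨j, hj⟩ := mem_iUnion.1 hx
      simp only [mem_iUnion]
      exact ⟨j, τ, hτ, N, K, hK, x, ⟨hj, hxK⟩, rfl⟩
    refine measure_mono_null hsub ?_
    refine measure_iUnion_null fun j => measure_iUnion_null fun τ => measure_iUnion_null fun hτ =>
      measure_iUnion_null fun N => (measure_biUnion_null_iff (hSc τ N)).2 fun K hK => ?_
    obtain ⟨l₀, hl₀⟩ := hτ
    have hKp := hSp τ N K hK
    obtain ⟨Λ, hΛ⟩ := hf1.locallyLipschitz.locallyLipschitzOn.exists_lipschitzOnWith_of_compact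
      hKp.1
    refine volume_image_eq_zero hf1.continuous hKp.1 hΛ l₀
      (fun ε hε => hKp.exists_dist_lt_imp hf hl₀ hε) ?_
    convert hT j using 3
    push_cast
    ring

end
end
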